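/- Let {Φ_i}_{i∈I} be a finite or countable family of positive linear trace-non-increasing maps from 𝔗(H) to 𝔗(H') such that sup_{ρ∈𝔖(H)} Σ_{i∈I} Tr Φ_i(ρ) < +∞. Then the output entropy of the map Σ_{i∈I} Φ_i is continuous on 𝔖(H) if the following condition holds: Σ_{i∈I} H(Φ_i(ρ)) < +∞ and H({Tr Φ_i(ρ)}_{i∈I}) < +∞ for all ρ ∈ 𝔖(H). Moreover, this condition is necessary if either supp Φ_i(ρ) ⟂ supp Φ_j(ρ) for all i ≠ j and all ρ ∈ 𝔖(H), or the index set I is finite. -/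

import Mathlib

open scoped ENNReal NNReal
open Filter Topology Classical
attribute [local instance] Classical.propDecidable

noncomputable section

namespace QIT

section Defs

variable {E F G : Type*}
variable [NormedAddCommGroup E] [InnerProductSpace ℂ E] [CompleteSpace E]
variable [NormedAddCommGroup F] [InnerProductSpace ℂ F] [CompleteSpace F]
variable [NormedAddCommGroup G] [InnerProductSpace ℂ G] [CompleteSpace G]

/-- The real part of `⟪x, A x⟫`. -/
def qf (A : E →L[ℂ] E) (x : E) : ℝ := (inner ℂ x (A x) : ℂ).re

/-- The trace of a positive operator, as the supremum of finite diagonal sums over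
finite orthonormal families.  For positive operators this coincides with the usual
trace (with value `∞` when the operator is not trace class). -/
def traceENN (A : E →L[ℂ] E) : ℝ≥0∞ :=
  ⨆ (n : ℕ) (e : Fin n → E) (_ : Orthonormal ℂ e), ∑ i, ENNReal.ofReal (qf A (e i))

/-- The trace norm `‖A‖₁`, as the supremum of `∑ |⟪e i, A (f i)⟫|` over pairs of finite
orthonormal families; it is finite exactly on trace-class operators. -/
def traceNorm (A : E →L[ℂ] E) : ℝ≥0∞ :=
  ⨆ (n : ℕ) (e : Fin n → E) (f : Fin n → E) (_ : Orthonormal ℂ e) (_ : Orthonormal ℂ f),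
    ∑ i, ENNReal.ofReal ‖(inner ℂ (e i) (A (f i)) : ℂ)‖

/-- `A` is a trace-class operator. -/
def IsTC (A : E →L[ℂ] E) : Prop := traceNorm A ≠ ∞

/-- The cone `𝔗₊(E)` of positive trace-class operators. -/
def posTC (E : Type*) [NormedAddCommGroup E] [InnerProductSpace ℂ E] [CompleteSpace E] :
    Set (E →L[ℂ] E) := {A | A.IsPositive ∧ IsTC A}

/-- The set `𝔖(E)` of states (density operators). -/
def states (E : Type*) [NormedAddCommGroup E] [InnerProductSpace ℂ E] [CompleteSpace E] :
    Set (E →L[ℂ] E) := {A | A.IsPositive ∧ traceENN A = 1}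

/-- The extended classical entropy `H({x_i}) = ∑ η(x_i) − η(∑ x_i)` of a nonnegative
summable family, written in the equivalent homogeneous form `(∑ x) · H({x_i/∑x})`. -/
def clEntropy {ι : Type*} (x : ι → ℝ) : ℝ≥0∞ :=
  ENNReal.ofReal (∑' i, x i) *
    ∑' i, ENNReal.ofReal (Real.negMulLog (x i / (∑' j, x j)))

/-- An orthonormal subset with dense span (an orthonormal basis, as a set). -/
def IsONB (s : Set E) : Prop :=
  Orthonormal ℂ ((↑) : s → E) ∧ Dense ((Submodule.span ℂ s : Submodule ℂ E) : Set E)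

/-- The quantum (von Neumann) entropy `H(A) = Tr η(A) − η(Tr A)` of a positive trace-class
operator, realized as the infimum over all orthonormal bases of the classical entropy of
the diagonal of `A` (the infimum is attained on an eigenbasis of `A`). -/
def qEntropy (A : E →L[ℂ] E) : ℝ≥0∞ :=
  ⨅ (s : Set E) (_ : IsONB s), clEntropy fun v : s => qf A v

theorem exists_isONB (E : Type*) [NormedAddCommGroup E] [InnerProductSpace ℂ E]
    [CompleteSpace E] : ∃ s : Set E, IsONB s := by
  obtain ⟨w, b, hb⟩ := exists_hilbertBasis ℂ E
  refine ⟨w, ?_, ?_⟩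
  · have h := b.orthonormal
    rwa [hb] at h
  · have h := b.dense_span
    rw [hb, Subtype.range_coe] at h
    rwa [Submodule.dense_iff_topologicalClosure_eq_top]

/-- A fixed orthonormal basis (as a set). -/
def stdONB (E : Type*) [NormedAddCommGroup E] [InnerProductSpace ℂ E] [CompleteSpace E] :
    Set E := (exists_isONB E).choose

/-- The `ℂ`-valued trace, computed in a fixed orthonormal basis; for trace-class
operators it does not depend on the choice of the basis. -/
def traceC (A : E →L[ℂ] E) : ℂ := ∑' v : stdONB E, (inner ℂ (v : E) (A v) : ℂ)

/-- Continuity (including finiteness) of an `ℝ≥0∞`-valued function on a subset of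
operators, with respect to the trace-norm distance. -/
def ContOn (f : (E →L[ℂ] E) → ℝ≥0∞) (𝒜 : Set (E →L[ℂ] E)) : Prop :=
  (∀ A ∈ 𝒜, f A ≠ ∞) ∧
  ∀ A ∈ 𝒜, ∀ ε : ℝ, 0 < ε → ∃ δ : ℝ, 0 < δ ∧
    ∀ B ∈ 𝒜, traceNorm (B - A) < ENNReal.ofReal δ → |(f B).toReal - (f A).toReal| < ε

/-- Continuity of a real-valued function on a subset of operators with respect to the
trace-norm distance. -/
def RContOn (g : (E →L[ℂ] E) → ℝ) (𝒜 : Set (E →L[ℂ] E)) : Prop :=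
  ∀ A ∈ 𝒜, ∀ ε : ℝ, 0 < ε → ∃ δ : ℝ, 0 < δ ∧
    ∀ B ∈ 𝒜, traceNorm (B - A) < ENNReal.ofReal δ → |g B - g A| < ε

/-- Boundedness of an `ℝ≥0∞`-valued function on a set. -/
def BddOn (f : (E →L[ℂ] E) → ℝ≥0∞) (𝒜 : Set (E →L[ℂ] E)) : Prop :=
  ∃ C : ℝ, ∀ A ∈ 𝒜, f A ≤ ENNReal.ofReal C

/-- Convergence of a sequence of operators in the trace norm. -/
def TendstoTN (A : ℕ → (E →L[ℂ] E)) (A₀ : E →L[ℂ] E) : Prop :=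
  ∀ ε : ℝ, 0 < ε → ∃ N : ℕ, ∀ n ≥ N, traceNorm (A n - A₀) < ENNReal.ofReal ε

/-- A positive linear map from the trace class of `E` to the trace class of `F`
(the values of `toFun` outside the trace class are irrelevant). -/
structure TraceMap (E F : Type*) [NormedAddCommGroup E] [InnerProductSpace ℂ E]
    [CompleteSpace E] [NormedAddCommGroup F] [InnerProductSpace ℂ F] [CompleteSpace F] where
  toFun : (E →L[ℂ] E) → (F →L[ℂ] F)
  map_add : ∀ A B, IsTC A → IsTC B → toFun (A + B) = toFun A + toFun B
  map_smul : ∀ (c : ℂ) A, IsTC A → toFun (c • A) = c • toFun A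
  maps_tc : ∀ A, IsTC A → IsTC (toFun A)
  pos : ∀ A, IsTC A → A.IsPositive → (toFun A).IsPositive

/-- A trace-non-increasing map. -/
def TraceMap.TNI (Φ : TraceMap E F) : Prop :=
  ∀ A, IsTC A → A.IsPositive → traceENN (Φ.toFun A) ≤ traceENN A

/-- A trace-preserving map. -/
def TraceMap.TP (Φ : TraceMap E F) : Prop :=
  ∀ A, IsTC A → A.IsPositive → traceENN (Φ.toFun A) = traceENN A

/-- A map bounded with respect to the trace norm. -/
def TraceMap.Bounded (Φ : TraceMap E F) : Prop :=
  ∃ C : ℝ≥0, ∀ A, traceNorm (Φ.toFun A) ≤ (C : ℝ≥0∞) * traceNorm A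

/-- The output entropy `H_Φ = H ∘ Φ`. -/
def outEntropy (Φ : TraceMap E F) (A : E →L[ℂ] E) : ℝ≥0∞ := qEntropy (Φ.toFun A)

/-- The rank-one operator `|x⟩⟨x|`. -/
def rankOne (x : E) : E →L[ℂ] E := (innerSL ℂ x).smulRight x

/-- The rank-one operator `|x⟩⟨y|`. -/
def rankOneM (x y : E) : E →L[ℂ] E := (innerSL ℂ y).smulRight x

end Defs

section Defs2

variable {E F G : Type*}
variable [NormedAddCommGroup E] [InnerProductSpace ℂ E] [CompleteSpace E]
variable [NormedAddCommGroup F] [InnerProductSpace ℂ F] [CompleteSpace F]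
variable [NormedAddCommGroup G] [InnerProductSpace ℂ G] [CompleteSpace G]

/-- The completely positive map `A ↦ ∑ᵢ Vᵢ A Vᵢ*` defined by a sequence of Kraus
operators. -/
def krausMap (V : ℕ → (E →L[ℂ] F)) (A : E →L[ℂ] E) : F →L[ℂ] F :=
  ∑' i, V i ∘L A ∘L ContinuousLinearMap.adjoint (V i)

/-- The Kraus condition `∑ᵢ Vᵢ* Vᵢ ≤ I` (all partial sums are dominated by `I`). -/
def KrausTNI (V : ℕ → (E →L[ℂ] F)) : Prop :=
  ∀ n : ℕ,
    ((1 : E →L[ℂ] E) - ∑ i ∈ Finset.range n, ContinuousLinearMap.adjoint (V i) ∘L V i).IsPositive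

/-- The Kraus condition `∑ᵢ Vᵢ* Vᵢ = I` (strong convergence), i.e. trace preservation. -/
def KrausTP (V : ℕ → (E →L[ℂ] F)) : Prop :=
  ∀ x : E, HasSum (fun i => (ContinuousLinearMap.adjoint (V i)) (V i x)) x

/-- `(Φ, Φt)` is a complementary pair of quantum operations: for some Kraus
representation `Φ(·) = ∑ᵢ Vᵢ (·) Vᵢ*` and some orthonormal basis `{bᵢ}` of `G`,
`Φt(A) = ∑_{i,j} Tr[Vᵢ A Vⱼ*] |bᵢ⟩⟨bⱼ|` (characterized by its matrix entries). -/
def IsComplementaryPair (Φ : TraceMap E F) (Φt : TraceMap E G) : Prop :=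
  ∃ (V : ℕ → (E →L[ℂ] F)) (b : HilbertBasis ℕ ℂ G),
    KrausTNI V ∧
    (∀ A, IsTC A → Φ.toFun A = krausMap V A) ∧
    (∀ A, IsTC A → ∀ i j : ℕ,
      (inner ℂ (b i) (Φt.toFun A (b j)) : ℂ) =
        traceC (V i ∘L A ∘L ContinuousLinearMap.adjoint (V j)))

/-- A map (on trace-class operators) preserves continuity of the entropy:
its output entropy is continuous on every subset of the positive trace-class cone on
which the von Neumann entropy is continuous. -/
def PCE (Φf : (E →L[ℂ] E) → (F →L[ℂ] F)) : Prop :=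
  ∀ 𝒜 : Set (E →L[ℂ] E), 𝒜 ⊆ posTC E → ContOn qEntropy 𝒜 →
    ContOn (fun A => qEntropy (Φf A)) 𝒜

/-- `μ` is the sequence of nonzero eigenvalues (with multiplicities, possibly padded by
zeros) of the diagonalizable positive operator `T`, every vector orthogonal to the
eigenvectors being annihilated by `T`. -/
def IsEigenSeq (T : E →L[ℂ] E) (μ : ℕ → ℝ) : Prop :=
  ∃ e : ℕ → E,
    (∀ i j, i ≠ j → (inner ℂ (e i) (e j) : ℂ) = 0) ∧
    (∀ i, (μ i ≠ 0 → ‖e i‖ = 1) ∧ (μ i = 0 → e i = 0)) ∧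
    (∀ i, T (e i) = (μ i : ℂ) • e i) ∧
    (∀ x : E, (∀ i, (inner ℂ (e i) x : ℂ) = 0) → T x = 0)

/-- `ν` is the sequence of singular values of `V` (eigenvalues of `√(V*V)`,
equivalently `ν²` are the eigenvalues of `V*V`). -/
def IsSingularValues (V : E →L[ℂ] F) (ν : ℕ → ℝ) : Prop :=
  (∀ i, 0 ≤ ν i) ∧ IsEigenSeq (ContinuousLinearMap.adjoint V ∘L V) (fun i => ν i ^ 2)

/-- `∑ᵢ e^{−l/νᵢ²}`, the sum being taken over the indices with `νᵢ ≠ 0`. -/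
def expSum (ν : ℕ → ℝ) (l : ℝ) : ℝ≥0∞ :=
  ∑' i, if ν i = 0 then 0 else ENNReal.ofReal (Real.exp (-(l / ν i ^ 2)))

/-- `λ*(V) < ∞`: `V` is compact (automatic here) and `∑ᵢ e^{−l/νᵢ²} < ∞` for some
`l > 0`, where `{νᵢ}` are the singular values of `V`. -/
def LamStarFin (V : E →L[ℂ] F) : Prop :=
  ∃ ν : ℕ → ℝ, IsSingularValues V ν ∧ ∃ l : ℝ, 0 < l ∧ expSum ν l ≠ ∞

/-- `λ*(√S) < ∞` for a positive operator `S` (the singular values of `√S` are the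
square roots of the eigenvalues of `S`). -/
def LamStarSqrtFin (S : E →L[ℂ] E) : Prop :=
  ∃ ν : ℕ → ℝ, (∀ i, 0 ≤ ν i) ∧ IsEigenSeq S (fun i => ν i ^ 2) ∧
    ∃ l : ℝ, 0 < l ∧ expSum ν l ≠ ∞

/-- The value `λ*` associated to a sequence `ν` of singular values: the unique solution
of `∑ᵢ e^{−λ/νᵢ²} = 1` if it exists, and `inf{λ > 0 | ∑ᵢ e^{−λ/νᵢ²} < ∞}` otherwise. -/
def lamStarOf (ν : ℕ → ℝ) : ℝ≥0∞ :=
  if h : ∃ l : ℝ, expSum ν l = 1 then ENNReal.ofReal h.choose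
  else ⨅ (l : ℝ) (_ : 0 < l ∧ expSum ν l ≠ ∞), ENNReal.ofReal l

/-- The parameter `λ*(V) ∈ [0,∞]` of a bounded operator `V`. -/
def lamStar (V : E →L[ℂ] F) : ℝ≥0∞ :=
  if h : ∃ ν : ℕ → ℝ, IsSingularValues V ν then lamStarOf h.choose else ∞

/-- `rank A ≤ k`. -/
def rankLE (A : E →L[ℂ] E) (k : ℕ) : Prop :=
  Module.rank ℂ (LinearMap.range (A : E →ₗ[ℂ] E)) ≤ k

/-- The set `𝔗₊ᵏ(E)` of positive (trace-class) operators of rank at most `k`. -/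
def rankCone (E : Type*) [NormedAddCommGroup E] [InnerProductSpace ℂ E] [CompleteSpace E]
    (k : ℕ) : Set (E →L[ℂ] E) := {A | A.IsPositive ∧ rankLE A k}

/-- A decomposition of `A` into a countable convex combination of positive operators of
rank at most `k`. -/
structure Decomp (k : ℕ) (A : E →L[ℂ] E) where
  π : ℕ → ℝ
  op : ℕ → (E →L[ℂ] E)
  π_nonneg : ∀ i, 0 ≤ π i
  π_sum : HasSum π 1
  op_pos : ∀ i, (op i).IsPositive
  op_rank : ∀ i, rankLE (op i) k
  sum_eq : HasSum (fun i => π i • op i) A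

/-- The `k`-order approximator `H_Φᵏ` of the output entropy of `Φ`. -/
def kApprox (Φf : (E →L[ℂ] E) → (F →L[ℂ] F)) (k : ℕ) (A : E →L[ℂ] E) : ℝ≥0∞ :=
  ⨆ d : Decomp k A, ∑' i, ENNReal.ofReal (d.π i) * qEntropy (Φf (d.op i))

/-- The set of pure states (extreme points of `𝔖(E)`). -/
def pureStates (E : Type*) [NormedAddCommGroup E] [InnerProductSpace ℂ E]
    [CompleteSpace E] : Set (E →L[ℂ] E) := {A | ∃ x : E, ‖x‖ = 1 ∧ A = rankOne x}

end Defs2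

section Tensor

variable (E F G : Type*)
variable [NormedAddCommGroup E] [InnerProductSpace ℂ E] [CompleteSpace E]
variable [NormedAddCommGroup F] [InnerProductSpace ℂ F] [CompleteSpace F]
variable [NormedAddCommGroup G] [InnerProductSpace ℂ G] [CompleteSpace G]

/-- A realization of `G` as the Hilbert tensor product `E ⊗ F`, together with the
tensor product of (bounded) operators. -/
structure TensorData where
  tmul : E → F → G
  add_left : ∀ x y z, tmul (x + y) z = tmul x z + tmul y z
  add_right : ∀ x y z, tmul x (y + z) = tmul x y + tmul x z
  smul_left : ∀ (c : ℂ) x y, tmul (c • x) y = c • tmul x y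
  smul_right : ∀ (c : ℂ) x y, tmul x (c • y) = c • tmul x y
  inner_tmul : ∀ x x' y y',
    (inner ℂ (tmul x y) (tmul x' y') : ℂ) = (inner ℂ x x' : ℂ) * (inner ℂ y y' : ℂ)
  dense_span : Dense ((Submodule.span ℂ {z | ∃ x y, z = tmul x y} : Submodule ℂ G) : Set G)
  omul : (E →L[ℂ] E) → (F →L[ℂ] F) → (G →L[ℂ] G)
  omul_tmul : ∀ A B x y, omul A B (tmul x y) = tmul (A x) (B y)

end Tensor

section Classical

variable {ι κ : Type*}

theorem tsum_eq_toReal_tsum_ofReal {f : ι → ℝ} (hf : ∀ i, 0 ≤ f i) :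
    ∑' i, f i = (∑' i, ENNReal.ofReal (f i)).toReal := by
  rw [ENNReal.tsum_toReal_eq fun _ => ENNReal.ofReal_ne_top]
  exact tsum_congr fun i => (ENNReal.toReal_ofReal (hf i)).symm

theorem clEntropy_eq (x : ι → ℝ) (hx : ∀ i, 0 ≤ x i) :
    clEntropy x = ∑' i, ENNReal.ofReal ((∑' j, x j) * Real.negMulLog (x i / ∑' j, x j)) := by
  rw [clEntropy, ← ENNReal.tsum_mul_left]
  exact tsum_congr fun i => (ENNReal.ofReal_mul (tsum_nonneg hx)).symm

theorem negMulLog_div_tsum_nonneg {x : ι → ℝ} (hx : ∀ i, 0 ≤ x i) (hs : Summable x) (i : ι) :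
    0 ≤ Real.negMulLog (x i / ∑' j, x j) :=
  Real.negMulLog_nonneg (div_nonneg (hx i) (tsum_nonneg hx))
    (div_le_one_of_le₀ (hs.le_tsum i fun j _ => hx j) (tsum_nonneg hx))

theorem clEntropy_eq_zero_of_tsum_eq_zero {x : ι → ℝ} (h : ∑' i, x i = 0) : clEntropy x = 0 := by
  simp [clEntropy, h]

/-- The perspective of a concave function is superadditive. -/
theorem negMulLog_perspective_add_le {X Y a b : ℝ} (hX : 0 < X) (hY : 0 < Y) (ha : 0 ≤ a)
    (hb : 0 ≤ b) :
    X * Real.negMulLog (a / X) + Y * Real.negMulLog (b / Y) ≤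
      (X + Y) * Real.negMulLog ((a + b) / (X + Y)) := by
  have hZ : 0 < X + Y := by positivity
  have h := Real.concaveOn_negMulLog.2 (Set.mem_Ici.2 (by positivity : 0 ≤ a / X))
    (Set.mem_Ici.2 (by positivity : 0 ≤ b / Y)) (by positivity : 0 ≤ X / (X + Y))
    (by positivity : 0 ≤ Y / (X + Y)) (by field_simp)
  simp only [smul_eq_mul] at h
  have e : X / (X + Y) * (a / X) + Y / (X + Y) * (b / Y) = (a + b) / (X + Y) := by
    field_simp
  rw [e] at h
  calc _ = (X + Y) * (X / (X + Y) * Real.negMulLog (a / X)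
        + Y / (X + Y) * Real.negMulLog (b / Y)) := by field_simp
    _ ≤ _ := by gcongr

theorem clEntropy_add_le {x y : ι → ℝ} (hx : ∀ i, 0 ≤ x i) (hy : ∀ i, 0 ≤ y i)
    (hxs : Summable x) (hys : Summable y) :
    clEntropy x + clEntropy y ≤ clEntropy fun i => x i + y i := by
  rcases (tsum_nonneg hx).eq_or_lt with hX | hX
  · have : x = 0 := (hasSum_zero_iff_of_nonneg hx).1 (hX ▸ hxs.hasSum)
    simp [this, clEntropy]
  rcases (tsum_nonneg hy).eq_or_lt with hY | hY
  · have : y = 0 := (hasSum_zero_iff_of_nonneg hy).1 (hY ▸ hys.hasSum)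
    simp [this, clEntropy]
  rw [clEntropy_eq x hx, clEntropy_eq y hy, clEntropy_eq _ fun i => add_nonneg (hx i) (hy i),
    ← ENNReal.tsum_add, hxs.tsum_add hys]
  refine ENNReal.tsum_le_tsum fun i => ?_
  rw [← ENNReal.ofReal_add (mul_nonneg hX.le (negMulLog_div_tsum_nonneg hx hxs i))
    (mul_nonneg hY.le (negMulLog_div_tsum_nonneg hy hys i))]
  exact ENNReal.ofReal_le_ofReal (negMulLog_perspective_add_le hX hY (hx i) (hy i))

theorem clEntropy_const_mul {c : ℝ} (hc : 0 < c) (x : ι → ℝ) :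
    clEntropy (fun i => c * x i) = ENNReal.ofReal c * clEntropy x := by
  simp only [clEntropy, tsum_mul_left, mul_div_mul_left _ _ hc.ne']
  rw [ENNReal.ofReal_mul hc.le, mul_assoc]

/-- Jensen's inequality for `negMulLog` and a countable subprobability vector. -/
theorem tsum_mul_negMulLog_le {l q : ι → ℝ} {p : ℝ} (hl : ∀ j, 0 ≤ l j) (hl1 : ∀ j, l j ≤ 1)
    (hq : ∀ j, 0 ≤ q j) (hq1 : ∀ J : Finset ι, ∑ j ∈ J, q j ≤ 1)
    (hp : HasSum (fun j => l j * q j) p) :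
    ∑' j, ENNReal.ofReal (q j * Real.negMulLog (l j)) ≤ ENNReal.ofReal (Real.negMulLog p) := by
  have hη : ∀ j, 0 ≤ Real.negMulLog (l j) := fun j => Real.negMulLog_nonneg (hl j) (hl1 j)
  have jensen : ∀ J : Finset ι, ∑ j ∈ J, q j * Real.negMulLog (l j) ≤
      Real.negMulLog (∑ j ∈ J, l j * q j) := by
    intro J
    have h := Real.concaveOn_negMulLog.le_map_sum (t := Finset.insertNone J)
      (w := fun o => o.elim (1 - ∑ j ∈ J, q j) q) (p := fun o => o.elim 0 l)
      (by rintro (_ | j) _ <;> simp [hq, hq1]) (by simp [Finset.sum_insertNone])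
      (by rintro (_ | j) _ <;> simp [hl])
    simpa [Finset.sum_insertNone, mul_comm] using h
  have hle : ∀ J : Finset ι, ∑ j ∈ J, q j * Real.negMulLog (l j) ≤ Real.negMulLog p := by
    intro J
    refine ge_of_tendsto ((Real.continuous_negMulLog.tendsto p).comp hp) ?_
    filter_upwards [eventually_ge_atTop J] with J' hJ'
    exact (Finset.sum_le_sum_of_subset_of_nonneg hJ'
      fun j _ _ => mul_nonneg (hq j) (hη j)).trans (jensen J')
  rw [ENNReal.tsum_eq_iSup_sum]
  refine iSup_le fun J => ?_
  rw [← ENNReal.ofReal_sum_of_nonneg fun j _ => mul_nonneg (hq j) (hη j)]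
  exact ENNReal.ofReal_le_ofReal (hle J)

/-- Mixing by a doubly (sub)stochastic matrix does not decrease the entropy. -/
theorem clEntropy_le_of_mixing {l : ι → ℝ} {p : κ → ℝ} {q : ι → κ → ℝ}
    (hl : ∀ j, 0 ≤ l j) (hls : Summable l) (hq : ∀ j k, 0 ≤ q j k)
    (hp : ∀ k, HasSum (fun j => l j * q j k) (p k))
    (hrow : ∀ j, l j ≠ 0 → ∑' k, ENNReal.ofReal (q j k) = 1)
    (hcol : ∀ k (J : Finset ι), ∑ j ∈ J, q j k ≤ 1) :
    clEntropy l ≤ clEntropy p := by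
  have hp0 : ∀ k, 0 ≤ p k := fun k => (hp k).nonneg fun j => mul_nonneg (hl j) (hq j k)
  have htot : ∑' k, p k = ∑' j, l j := by
    rw [tsum_eq_toReal_tsum_ofReal hp0, tsum_eq_toReal_tsum_ofReal hl]
    congr 1
    calc ∑' k, ENNReal.ofReal (p k) = ∑' k, ∑' j, ENNReal.ofReal (l j * q j k) :=
          tsum_congr fun k => by
            rw [← (hp k).tsum_eq, ENNReal.ofReal_tsum_of_nonneg
              (fun j => mul_nonneg (hl j) (hq j k)) (hp k).summable]
      _ = ∑' j, ∑' k, ENNReal.ofReal (l j * q j k) := ENNReal.tsum_comm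
      _ = ∑' j, ENNReal.ofReal (l j) := tsum_congr fun j => by
          by_cases h : l j = 0
          · simp [h]
          · simp_rw [ENNReal.ofReal_mul (hl j), ENNReal.tsum_mul_left, hrow j h, mul_one]
  rcases (tsum_nonneg hl).eq_or_lt with hT | hT
  · rw [clEntropy_eq_zero_of_tsum_eq_zero hT.symm]
    exact zero_le
  rw [clEntropy, clEntropy, htot]
  refine mul_le_mul_right ?_ _
  set T := ∑' j, l j
  calc ∑' j, ENNReal.ofReal (Real.negMulLog (l j / T))
      ≤ ∑' j, ∑' k, ENNReal.ofReal (q j k * Real.negMulLog (l j / T)) := by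
        refine ENNReal.tsum_le_tsum fun j => ?_
        by_cases h : l j = 0
        · simp [h]
        · simp_rw [ENNReal.ofReal_mul (hq j _), ENNReal.tsum_mul_right, hrow j h, one_mul]
          exact le_rfl
    _ = ∑' k, ∑' j, ENNReal.ofReal (q j k * Real.negMulLog (l j / T)) := ENNReal.tsum_comm
    _ ≤ _ := by
        refine ENNReal.tsum_le_tsum fun k => tsum_mul_negMulLog_le
          (fun j => div_nonneg (hl j) hT.le)
          (fun j => div_le_one_of_le₀ (hls.le_tsum j fun i _ => hl i) hT.le)
          (fun j => hq j k) (hcol k) ?_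
        simpa only [div_mul_eq_mul_div] using (hp k).div_const T

/-- The chain rule for the classical entropy. -/
theorem clEntropy_sigma_le {κ : ι → Type*} {x : (Σ i, κ i) → ℝ} (hx : ∀ k, 0 ≤ x k)
    (hs : Summable x) :
    clEntropy x ≤ ∑' i, clEntropy (fun k => x ⟨i, k⟩) + clEntropy fun i => ∑' k, x ⟨i, k⟩ := by
  have hX0 : ∀ i, 0 ≤ ∑' k, x ⟨i, k⟩ := fun i => tsum_nonneg fun k => hx _
  have hXs : Summable fun i => ∑' k, x ⟨i, k⟩ := hs.sigma
  have hxi : ∀ i, Summable fun k => x ⟨i, k⟩ := fun i => hs.sigma_factor i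
  rw [clEntropy_eq x hx, clEntropy_eq _ hX0, ENNReal.tsum_sigma', ← ENNReal.tsum_add,
    ← hs.tsum_sigma]
  refine ENNReal.tsum_le_tsum fun i => ?_
  rw [clEntropy_eq _ fun k => hx ⟨i, k⟩]
  set T := ∑' k, x k
  set X := ∑' k, x ⟨i, k⟩
  have hT0 : 0 ≤ T := tsum_nonneg hx
  rcases (hX0 i).eq_or_lt with h0 | h0
  · have h : ∀ k, x ⟨i, k⟩ = 0 := fun k =>
      congrFun ((hasSum_zero_iff_of_nonneg fun k => hx ⟨i, k⟩).1 (h0 ▸ (hxi i).hasSum)) k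
    simp [h]
  replace h0 : 0 < X := h0
  have hXT : X ≤ T := by
    have := hXs.le_tsum i fun j _ => hX0 j
    rwa [← hs.tsum_sigma] at this
  have hT : 0 < T := h0.trans_le hXT
  have hη : 0 ≤ Real.negMulLog (X / T) :=
    Real.negMulLog_nonneg (div_nonneg h0.le hT0) (div_le_one_of_le₀ hXT hT0)
  have hη' : ∀ k, 0 ≤ Real.negMulLog (x ⟨i, k⟩ / X) :=
    negMulLog_div_tsum_nonneg (fun k => hx ⟨i, k⟩) (hxi i)
  have hterm : ∀ k, ENNReal.ofReal (T * Real.negMulLog (x ⟨i, k⟩ / T)) =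
      ENNReal.ofReal (X * Real.negMulLog (x ⟨i, k⟩ / X)) +
        ENNReal.ofReal (x ⟨i, k⟩) * ENNReal.ofReal (T * Real.negMulLog (X / T) / X) := by
    intro k
    rw [← ENNReal.ofReal_mul (hx _), ← ENNReal.ofReal_add
      (mul_nonneg h0.le (hη' k))
      (mul_nonneg (hx _) (by positivity))]
    congr 1
    have e : x ⟨i, k⟩ / T = x ⟨i, k⟩ / X * (X / T) := by field_simp
    rw [e, Real.negMulLog_mul]
    field_simp
  simp_rw [hterm]
  rw [ENNReal.tsum_add, ENNReal.tsum_mul_right,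
    ← ENNReal.ofReal_tsum_of_nonneg (fun k => hx ⟨i, k⟩) (hxi i), ← ENNReal.ofReal_mul h0.le]
  have e : X * (T * Real.negMulLog (X / T) / X) = T * Real.negMulLog (X / T) := by field_simp
  rw [e]

theorem clEntropy_ne_top_of_finite [Finite ι] (x : ι → ℝ) : clEntropy x ≠ ∞ := by
  have := Fintype.ofFinite ι
  rw [clEntropy, tsum_fintype (L := .unconditional ι) fun i => ENNReal.ofReal _]
  exact ENNReal.mul_ne_top ENNReal.ofReal_ne_top
    (ENNReal.sum_ne_top.2 fun _ _ => ENNReal.ofReal_ne_top)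

theorem mul_negMulLog_div_le_two_mul_sqrt {b s : ℝ} (hb : 0 ≤ b) (hs : 0 < s) :
    s * Real.negMulLog (b / s) ≤ 2 * √(b * s) := by
  rcases hb.eq_or_lt with rfl | hb
  · simp
  have hlog : Real.log (b / s) = -(2 * Real.log √(s / b)) := by
    rw [Real.log_sqrt (by positivity), ← inv_div, Real.log_inv]
    ring
  have hle : Real.log √(s / b) ≤ √(s / b) := Real.log_le_self (Real.sqrt_nonneg _)
  calc s * Real.negMulLog (b / s) = 2 * (b * Real.log √(s / b)) := by
        rw [Real.negMulLog, hlog]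
        field_simp
    _ ≤ 2 * (b * √(s / b)) := by gcongr
    _ = 2 * √(b * s) := by
        have : b * s = b ^ 2 * (s / b) := by field_simp
        rw [this, Real.sqrt_mul (by positivity), Real.sqrt_sq hb.le]

theorem clEntropy_bool_le {x : Bool → ℝ} (hx : ∀ i, 0 ≤ x i) {c d : ℝ} (hc : x false ≤ c)
    (hd : x true ≤ d) :
    clEntropy x ≤ ENNReal.ofReal (d + 2 * √(d * (c + d))) := by
  rcases (tsum_nonneg hx).eq_or_lt with hT | hT
  · rw [clEntropy_eq_zero_of_tsum_eq_zero hT.symm]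
    exact zero_le
  rw [clEntropy_eq x hx, tsum_bool]
  have e : ∑' j, x j = x false + x true := tsum_bool _
  rw [e] at hT ⊢
  have h0 := hx false
  have h1 := hx true
  rw [← ENNReal.ofReal_add]
  · refine ENNReal.ofReal_le_ofReal (add_le_add ?_ ?_)
    · calc _ ≤ (x false + x true) * (1 - x false / (x false + x true)) := by
            gcongr
            exact Real.negMulLog_le_one_sub_self (by positivity)
        _ = x true := by field_simp; ring
        _ ≤ d := hd
    · refine (mul_negMulLog_div_le_two_mul_sqrt h1 hT).trans ?_
      have : 0 ≤ d := h1.trans hd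
      gcongr
  all_goals
    refine mul_nonneg hT.le (Real.negMulLog_nonneg (by positivity) ?_)
    exact div_le_one_of_le₀ (by linarith) hT.le

end Classical

section InnerProduct

variable {E ι : Type*} [NormedAddCommGroup E] [InnerProductSpace ℂ E]

theorem qf_nonneg {A : E →L[ℂ] E} (hA : A.IsPositive) (x : E) : 0 ≤ qf A x :=
  hA.re_inner_nonneg_right x

theorem qf_add (A B : E →L[ℂ] E) (x : E) : qf (A + B) x = qf A x + qf B x := by
  simp [qf]

theorem qf_smul (c : ℝ) (A : E →L[ℂ] E) (x : E) : qf ((c : ℂ) • A) x = c * qf A x := by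
  simp [qf]

theorem hasSum_qf {A : ι → E →L[ℂ] E} {S : E →L[ℂ] E} (h : HasSum A S) (x : E) :
    HasSum (fun i => qf (A i) x) (qf S x) := by
  have h1 : HasSum (fun i => A i x) (S x) := h.mapL (ContinuousLinearMap.apply ℂ E x)
  exact Complex.hasSum_re (h1.mapL (innerSL ℂ x))

theorem isPositive_real_smul {A : E →L[ℂ] E} (hA : A.IsPositive) {c : ℝ} (hc : 0 ≤ c) :
    ((c : ℂ) • A).IsPositive :=
  hA.smul_of_nonneg (Complex.zero_le_real.2 hc)

theorem inner_mul_self_right {R : E →L[ℂ] E} (hR : R.IsPositive) (x y : E) :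
    (inner ℂ x ((R * R) y) : ℂ) = inner ℂ (R x) (R y) :=
  (hR.inner_left_eq_inner_right x (R y)).symm

theorem qf_mul_self {R : E →L[ℂ] E} (hR : R.IsPositive) (x : E) :
    qf (R * R) x = ‖R x‖ ^ 2 := by
  rw [qf, inner_mul_self_right hR]
  exact inner_self_eq_norm_sq (𝕜 := ℂ) (R x)

theorem tsum_norm_inner_sq_le {e : ι → E} (he : Orthonormal ℂ e) (x : E) :
    ∑' i, ENNReal.ofReal (‖(inner ℂ (e i) x : ℂ)‖ ^ 2) ≤ ENNReal.ofReal (‖x‖ ^ 2) := by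
  rw [ENNReal.tsum_eq_iSup_sum]
  refine iSup_le fun J => ?_
  rw [← ENNReal.ofReal_sum_of_nonneg fun _ _ => by positivity]
  exact ENNReal.ofReal_le_ofReal (he.sum_inner_products_le x)

theorem tsum_qf_le_traceENN (A : E →L[ℂ] E) {e : ι → E} (he : Orthonormal ℂ e) :
    ∑' i, ENNReal.ofReal (qf A (e i)) ≤ traceENN A := by
  rw [ENNReal.tsum_eq_iSup_sum]
  refine iSup_le fun J => ?_
  have h : Orthonormal ℂ fun m : Fin J.card => e (J.equivFin.symm m) :=
    he.comp _ (Subtype.val_injective.comp J.equivFin.symm.injective)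
  refine le_of_eq_of_le ?_ (le_iSup₂_of_le J.card _ (le_iSup_of_le h le_rfl))
  rw [Equiv.sum_comp J.equivFin.symm fun i : J => ENNReal.ofReal (qf A (e i)),
    Finset.sum_coe_sort J fun i => ENNReal.ofReal (qf A (e i))]

theorem ofReal_qf_le_traceENN {A : E →L[ℂ] E} {x : E} (hx : ‖x‖ = 1) :
    ENNReal.ofReal (qf A x) ≤ traceENN A := by
  have h : Orthonormal ℂ fun _ : Unit => x :=
    ⟨fun _ => hx, fun i j hij => (hij (Subsingleton.elim i j)).elim⟩
  simpa using tsum_qf_le_traceENN A h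

theorem qf_le_trace_mul {A : E →L[ℂ] E} (hT : traceENN A ≠ ∞) (x : E) :
    qf A x ≤ (traceENN A).toReal * ‖x‖ ^ 2 := by
  rcases eq_or_ne x 0 with rfl | hx
  · simp [qf]
  have hx' : ‖x‖ ≠ 0 := norm_ne_zero_iff.2 hx
  have h1 : ‖((‖x‖⁻¹ : ℝ) : ℂ) • x‖ = 1 := by simp [norm_smul, hx']
  have h2 : qf A (((‖x‖⁻¹ : ℝ) : ℂ) • x) = ‖x‖⁻¹ ^ 2 * qf A x := by
    simp only [qf, map_smul, inner_smul_left, inner_smul_right, Complex.conj_ofReal,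
      Complex.re_ofReal_mul]
    ring
  have h3 := (ENNReal.ofReal_le_iff_le_toReal hT).1 (ofReal_qf_le_traceENN (A := A) h1)
  rw [h2] at h3
  calc qf A x = (‖x‖⁻¹ ^ 2 * qf A x) * ‖x‖ ^ 2 := by field_simp
    _ ≤ _ := by gcongr

theorem hasSum_norm_inner_sq (b : HilbertBasis ι ℂ E) (x : E) :
    HasSum (fun i => ‖(inner ℂ (b i) x : ℂ)‖ ^ 2) (‖x‖ ^ 2) := by
  have h := Complex.hasSum_re (b.hasSum_inner_mul_inner x x)
  have e : (inner ℂ x x : ℂ).re = ‖x‖ ^ 2 := inner_self_eq_norm_sq (𝕜 := ℂ) x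
  rw [e] at h
  convert h using 2 with i
  rw [← inner_conj_symm, Complex.mul_conj, Complex.ofReal_re, Complex.normSq_eq_norm_sq,
    RCLike.norm_conj]

theorem tsum_norm_inner_sq (b : HilbertBasis ι ℂ E) (x : E) :
    ∑' i, ENNReal.ofReal (‖(inner ℂ (b i) x : ℂ)‖ ^ 2) = ENNReal.ofReal (‖x‖ ^ 2) := by
  rw [← (hasSum_norm_inner_sq b x).tsum_eq, ENNReal.ofReal_tsum_of_nonneg (fun _ => by positivity)
    (hasSum_norm_inner_sq b x).summable]

end InnerProduct

section Operators

variable {E ι κ : Type*}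
variable [NormedAddCommGroup E] [InnerProductSpace ℂ E] [CompleteSpace E]

theorem isPositive_of_hasSum {A : ι → E →L[ℂ] E} {S : E →L[ℂ] E} (h : HasSum A S)
    (hA : ∀ i, (A i).IsPositive) : S.IsPositive := by
  rw [← ContinuousLinearMap.nonneg_iff_isPositive]
  exact h.nonneg fun i => (ContinuousLinearMap.nonneg_iff_isPositive _).2 (hA i)

theorem exists_sqrt {A : E →L[ℂ] E} (hA : A.IsPositive) :
    ∃ R : E →L[ℂ] E, R.IsPositive ∧ R * R = A :=
  have h := (ContinuousLinearMap.nonneg_iff_isPositive A).2 hA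
  ⟨CFC.sqrt A, (ContinuousLinearMap.nonneg_iff_isPositive _).1 (CFC.sqrt_nonneg A),
    CFC.sqrt_mul_sqrt_self A h⟩

theorem IsONB.exists_hilbertBasis {s : Set E} (hs : IsONB s) :
    ∃ b : HilbertBasis s ℂ E, ⇑b = ((↑) : s → E) := by
  refine ⟨HilbertBasis.mk hs.1 ?_, HilbertBasis.coe_mk hs.1 _⟩
  rw [Subtype.range_coe]
  exact (Submodule.dense_iff_topologicalClosure_eq_top.1 hs.2).ge

theorem tsum_qf_le_of_hilbertBasis {A : E →L[ℂ] E} (hA : A.IsPositive) {e : ι → E}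
    (he : Orthonormal ℂ e) (b : HilbertBasis κ ℂ E) :
    ∑' i, ENNReal.ofReal (qf A (e i)) ≤ ∑' k, ENNReal.ofReal (qf A (b k)) := by
  obtain ⟨R, hR, rfl⟩ := exists_sqrt hA
  simp_rw [qf_mul_self hR]
  calc ∑' i, ENNReal.ofReal (‖R (e i)‖ ^ 2)
      = ∑' i, ∑' k, ENNReal.ofReal (‖(inner ℂ (e i) (R (b k)) : ℂ)‖ ^ 2) :=
        tsum_congr fun i => by
          rw [← tsum_norm_inner_sq b]
          refine tsum_congr fun k => ?_
          rw [← hR.inner_left_eq_inner_right, norm_inner_symm]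
    _ = ∑' k, ∑' i, ENNReal.ofReal (‖(inner ℂ (e i) (R (b k)) : ℂ)‖ ^ 2) := ENNReal.tsum_comm
    _ ≤ _ := ENNReal.tsum_le_tsum fun k => tsum_norm_inner_sq_le he _

theorem traceENN_eq_tsum_hilbertBasis {A : E →L[ℂ] E} (hA : A.IsPositive)
    (b : HilbertBasis κ ℂ E) : traceENN A = ∑' k, ENNReal.ofReal (qf A (b k)) := by
  refine le_antisymm ?_ (tsum_qf_le_traceENN A b.orthonormal)
  refine iSup_le fun n => iSup₂_le fun e he => ?_
  rw [← tsum_fintype (L := .unconditional _)]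
  exact tsum_qf_le_of_hilbertBasis hA he b

theorem traceENN_eq_tsum {A : E →L[ℂ] E} (hA : A.IsPositive) {s : Set E} (hs : IsONB s) :
    traceENN A = ∑' v : s, ENNReal.ofReal (qf A v) := by
  obtain ⟨b, hb⟩ := hs.exists_hilbertBasis
  rw [traceENN_eq_tsum_hilbertBasis hA b, hb]

theorem tsum_qf_eq {A : E →L[ℂ] E} (hA : A.IsPositive) {s : Set E} (hs : IsONB s) :
    ∑' v : s, qf A v = (traceENN A).toReal := by
  rw [tsum_eq_toReal_tsum_ofReal fun v : s => qf_nonneg hA v, traceENN_eq_tsum hA hs]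

theorem summable_qf {A : E →L[ℂ] E} (hA : A.IsPositive) (hT : traceENN A ≠ ∞) {s : Set E}
    (hs : IsONB s) : Summable fun v : s => qf A v := by
  rw [traceENN_eq_tsum hA hs] at hT
  simpa only [ENNReal.toReal_ofReal (qf_nonneg hA _)] using ENNReal.summable_toReal hT

theorem traceENN_hasSum {A : ι → E →L[ℂ] E} {S : E →L[ℂ] E} (hA : ∀ i, (A i).IsPositive)
    (h : HasSum A S) : traceENN S = ∑' i, traceENN (A i) := by
  obtain ⟨s, hs⟩ := exists_isONB E
  rw [traceENN_eq_tsum (isPositive_of_hasSum h hA) hs]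
  simp_rw [traceENN_eq_tsum (hA _) hs]
  rw [ENNReal.tsum_comm]
  refine tsum_congr fun v => ?_
  rw [← (hasSum_qf h v).tsum_eq, ENNReal.ofReal_tsum_of_nonneg (fun i => qf_nonneg (hA i) _)
    (hasSum_qf h v).summable]

theorem traceENN_add {A B : E →L[ℂ] E} (hA : A.IsPositive) (hB : B.IsPositive) :
    traceENN (A + B) = traceENN A + traceENN B := by
  obtain ⟨s, hs⟩ := exists_isONB E
  rw [traceENN_eq_tsum (hA.add hB) hs, traceENN_eq_tsum hA hs, traceENN_eq_tsum hB hs,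
    ← ENNReal.tsum_add]
  refine tsum_congr fun v => ?_
  rw [qf_add, ENNReal.ofReal_add (qf_nonneg hA _) (qf_nonneg hB _)]

theorem traceENN_smul {A : E →L[ℂ] E} (hA : A.IsPositive) {c : ℝ} (hc : 0 ≤ c) :
    traceENN ((c : ℂ) • A) = ENNReal.ofReal c * traceENN A := by
  obtain ⟨s, hs⟩ := exists_isONB E
  rw [traceENN_eq_tsum (isPositive_real_smul hA hc) hs, traceENN_eq_tsum hA hs,
    ← ENNReal.tsum_mul_left]
  refine tsum_congr fun v => ?_
  rw [qf_smul, ENNReal.ofReal_mul hc]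

theorem norm_le_trace {A : E →L[ℂ] E} (hA : A.IsPositive) (hT : traceENN A ≠ ∞) :
    ‖A‖ ≤ (traceENN A).toReal := by
  obtain ⟨R, hR, hRA⟩ := exists_sqrt hA
  have h0 : 0 ≤ (traceENN A).toReal := ENNReal.toReal_nonneg
  have hRn : ‖R‖ ≤ √(traceENN A).toReal := by
    refine R.opNorm_le_bound (Real.sqrt_nonneg _) fun x => ?_
    refine le_of_sq_le_sq ?_ (by positivity)
    rw [mul_pow, Real.sq_sqrt h0, ← qf_mul_self hR, hRA]
    exact qf_le_trace_mul hT x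
  calc ‖A‖ = ‖R * R‖ := by rw [hRA]
    _ ≤ ‖R‖ * ‖R‖ := norm_mul_le _ _
    _ ≤ √(traceENN A).toReal * √(traceENN A).toReal := by gcongr
    _ = _ := Real.mul_self_sqrt h0

theorem summable_of_tsum_traceENN_ne_top {A : ι → E →L[ℂ] E} (hA : ∀ i, (A i).IsPositive)
    (hT : ∑' i, traceENN (A i) ≠ ∞) : Summable A :=
  Summable.of_norm_bounded (ENNReal.summable_toReal hT)
    fun i => norm_le_trace (hA i) (ENNReal.ne_top_of_tsum_ne_top hT i)

theorem traceNorm_le_traceENN {A : E →L[ℂ] E} (hA : A.IsPositive) : traceNorm A ≤ traceENN A := by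
  obtain ⟨R, hR, hRA⟩ := exists_sqrt hA
  refine iSup₂_le fun n e => iSup₂_le fun f he => iSup_le fun hf => ?_
  have hterm : ∀ i, ENNReal.ofReal ‖(inner ℂ (e i) (A (f i)) : ℂ)‖ ≤
      2⁻¹ * (ENNReal.ofReal (qf A (e i)) + ENNReal.ofReal (qf A (f i))) := by
    intro i
    rw [← ENNReal.ofReal_add (qf_nonneg hA _) (qf_nonneg hA _), ← hRA, qf_mul_self hR,
      qf_mul_self hR, inner_mul_self_right hR]
    have : (2 : ℝ≥0∞)⁻¹ = ENNReal.ofReal 2⁻¹ := by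
      rw [ENNReal.ofReal_inv_of_pos two_pos]; simp
    rw [this, ← ENNReal.ofReal_mul (by positivity)]
    refine ENNReal.ofReal_le_ofReal ((norm_inner_le_norm _ _).trans ?_)
    nlinarith [sq_nonneg (‖R (e i)‖ - ‖R (f i)‖)]
  have h1 : ∀ {g : Fin n → E}, Orthonormal ℂ g → ∑ i, ENNReal.ofReal (qf A (g i)) ≤ traceENN A :=
    fun {g} hg => le_iSup₂_of_le n g (le_iSup_of_le hg le_rfl)
  calc _ ≤ ∑ i, 2⁻¹ * (ENNReal.ofReal (qf A (e i)) + ENNReal.ofReal (qf A (f i))) :=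
        Finset.sum_le_sum fun i _ => hterm i
    _ ≤ 2⁻¹ * (traceENN A + traceENN A) := by
        rw [← Finset.mul_sum, Finset.sum_add_distrib]
        gcongr
        · exact h1 he
        · exact h1 hf
    _ = traceENN A := by
        rw [← two_mul, ← mul_assoc, ENNReal.inv_mul_cancel (by simp) (by simp), one_mul]

theorem isTC_of_isPositive {A : E →L[ℂ] E} (hA : A.IsPositive) (hT : traceENN A ≠ ∞) : IsTC A :=
  ne_top_of_le_ne_top hT (traceNorm_le_traceENN hA)

/-- A positive operator with finite trace is compact. -/
theorem isCompactOperator_of_isPositive {A : E →L[ℂ] E} (hA : A.IsPositive)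
    (hT : traceENN A ≠ ∞) : IsCompactOperator A := by
  obtain ⟨R, hR, hRA⟩ := exists_sqrt hA
  obtain ⟨w, b, -⟩ := _root_.exists_hilbertBasis ℂ E
  have hs : Summable fun v => ‖R (b v)‖ ^ 2 := by
    rw [traceENN_eq_tsum_hilbertBasis hA b] at hT
    refine (ENNReal.summable_toReal hT).congr fun v => ?_
    rw [ENNReal.toReal_ofReal (qf_nonneg hA _), ← hRA, qf_mul_self hR]
  set P : Finset w → E →L[ℂ] E := fun J => ∑ v ∈ J, (innerSL ℂ (R (b v))).smulRight (b v)
  have hP : ∀ J x, P J x = ∑ v ∈ J, (inner ℂ (R (b v)) x : ℂ) • b v := by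
    intro J x; simp [P]
  have hcoord : ∀ J x v, (inner ℂ (b v) ((R - P J) x) : ℂ) =
      if v ∈ J then 0 else inner ℂ (R (b v)) x := by
    intro J x v
    rw [sub_apply, hP, inner_sub_right, inner_sum,
      ← hR.inner_left_eq_inner_right]
    simp_rw [inner_smul_right, orthonormal_iff_ite.1 b.orthonormal]
    by_cases hv : v ∈ J <;> simp [hv]
  have hnorm : ∀ J, ‖R - P J‖ ≤ √((∑' v, ‖R (b v)‖ ^ 2) - ∑ v ∈ J, ‖R (b v)‖ ^ 2) := by
    intro J
    have htail : HasSum (fun v => if v ∈ J then 0 else ‖R (b v)‖ ^ 2)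
        ((∑' v, ‖R (b v)‖ ^ 2) - ∑ v ∈ J, ‖R (b v)‖ ^ 2) := by
      have h := hs.hasSum.sub (hasSum_sum_of_ne_finset_zero (s := J)
        (f := fun v => if v ∈ J then ‖R (b v)‖ ^ 2 else 0) fun v hv => if_neg hv)
      rw [Finset.sum_congr rfl fun v hv => if_pos hv] at h
      rw [show (fun v => if v ∈ J then 0 else ‖R (b v)‖ ^ 2) =
          fun v => ‖R (b v)‖ ^ 2 - if v ∈ J then ‖R (b v)‖ ^ 2 else 0 from funext fun v => ?_]
      · exact h
      split_ifs <;> simp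
    refine ContinuousLinearMap.opNorm_le_bound _ (Real.sqrt_nonneg _) fun x => ?_
    refine le_of_sq_le_sq ?_ (by positivity)
    rw [mul_pow, Real.sq_sqrt (htail.nonneg fun v => by split_ifs <;> positivity)]
    refine hasSum_le (fun v => ?_) (hasSum_norm_inner_sq b ((R - P J) x))
      (htail.mul_right (‖x‖ ^ 2))
    rw [hcoord]
    split_ifs
    · simp
    · rw [← mul_pow]
      exact pow_le_pow_left₀ (norm_nonneg _) (norm_inner_le_norm _ _) 2
  have hlim : Tendsto P atTop (𝓝 R) := by
    rw [tendsto_iff_norm_sub_tendsto_zero]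
    refine squeeze_zero (fun _ => norm_nonneg _) (fun J => (norm_sub_rev _ _).trans_le (hnorm J)) ?_
    have h := (tendsto_const_nhds.sub hs.hasSum).sqrt (f := fun J : Finset w =>
      (∑' v, ‖R (b v)‖ ^ 2) - ∑ v ∈ J, ‖R (b v)‖ ^ 2)
    simpa using h
  have hRc : IsCompactOperator R := by
    refine isCompactOperator_of_tendsto hlim (Eventually.of_forall fun J => ?_)
    refine (compactOperator (RingHom.id ℂ) E E).sum_mem fun v _ => ?_
    have h : IsCompactOperator (innerSL ℂ (R (b v))) :=
      isCompactOperator_of_locallyCompactSpace_dom _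
    exact h.clm_comp ((ContinuousLinearMap.id ℂ ℂ).smulRight (b v))
  rw [← hRA]
  exact hRc.comp_clm R

/-- A compact self-adjoint operator has an orthonormal basis of eigenvectors. -/
theorem exists_isONB_eigenvectors {T : E →L[ℂ] E} (hT : IsCompactOperator T)
    (hsa : IsSelfAdjoint T) :
    ∃ s : Set E, IsONB s ∧ ∀ v ∈ s, ∃ μ : ℝ, T v = (μ : ℂ) • v := by
  have hsym : T.IsSymmetric := hsa.isSymmetric
  have hcl : ∀ μ : ℂ, CompleteSpace (Module.End.eigenspace (T : Module.End ℂ E) μ) := fun μ => by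
    have h : IsClosed {x : E | T x = μ • x} := isClosed_eq T.continuous (continuous_const_smul μ)
    have h' : {x : E | T x = μ • x} = Module.End.eigenspace (T : Module.End ℂ E) μ := by
      ext x; simp
    rw [h'] at h
    exact h.completeSpace_coe
  choose w b hb using fun μ : ℂ =>
    _root_.exists_hilbertBasis ℂ (Module.End.eigenspace (T : Module.End ℂ E) μ)
  have ho := hsym.orthogonalFamily_eigenspaces.orthonormal_sigma_orthonormal
    fun μ => (b μ).orthonormal
  refine ⟨_, ⟨ho.toSubtypeRange, ?_⟩, ?_⟩
  · rw [Submodule.dense_iff_topologicalClosure_eq_top, Submodule.topologicalClosure_eq_top_iff,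
      Submodule.eq_bot_iff]
    intro x hx
    have hmem : x ∈ (⨆ μ, Module.End.eigenspace (T : Module.End ℂ E) μ)ᗮ := by
      rw [← Submodule.iInf_orthogonal, Submodule.mem_iInf]
      intro μ
      rw [Submodule.mem_orthogonal']
      intro y hy
      have h := ((((b μ).hasSum_repr ⟨y, hy⟩).mapL
        (Module.End.eigenspace (T : Module.End ℂ E) μ).subtypeL).mapL (innerSL ℂ x))
      refine h.unique ?_
      convert hasSum_zero with k
      have hk := (Submodule.mem_orthogonal' _ _).1 hx (b μ k)
        (Submodule.subset_span ⟨⟨μ, k⟩, rfl⟩)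
      simp [hk]
    rwa [ContinuousLinearMap.orthogonalComplement_iSup_eigenspaces_eq_bot hT hsym,
      Submodule.mem_bot] at hmem
  · rintro _ ⟨⟨μ, k⟩, rfl⟩
    have hk : T (b μ k : E) = μ • (b μ k : E) := Module.End.mem_eigenspace_iff.1 (b μ k).2
    have hne : (b μ k : E) ≠ 0 := by
      intro h0
      exact (b μ).orthonormal.ne_zero k (Subtype.ext h0)
    have hμ := hsym.conj_eigenvalue_eq_self
      (Module.End.hasEigenvalue_of_hasEigenvector ⟨(b μ k).2, hne⟩)
    exact ⟨μ.re, by rw [Complex.conj_eq_iff_re.1 hμ]; exact hk⟩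

end Operators

section Entropy

variable {E ι : Type*} [NormedAddCommGroup E] [InnerProductSpace ℂ E]

theorem qEntropy_smul {c : ℝ} (hc : 0 < c) (A : E →L[ℂ] E) :
    qEntropy ((c : ℂ) • A) = ENNReal.ofReal c * qEntropy A := by
  have h0 : ENNReal.ofReal c ≠ 0 := by simpa using hc
  simp only [qEntropy, qf_smul, clEntropy_const_mul hc]
  rw [ENNReal.mul_iInf_of_ne h0 ENNReal.ofReal_ne_top]
  exact iInf_congr fun s => (ENNReal.mul_iInf_of_ne h0 ENNReal.ofReal_ne_top).symm

variable [CompleteSpace E]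

theorem qEntropy_add_le {A B : E →L[ℂ] E} (hA : A.IsPositive) (hB : B.IsPositive)
    (hAT : traceENN A ≠ ∞) (hBT : traceENN B ≠ ∞) :
    qEntropy A + qEntropy B ≤ qEntropy (A + B) := by
  refine le_iInf₂ fun s hs => ?_
  simp_rw [qf_add]
  exact (add_le_add (iInf₂_le s hs) (iInf₂_le s hs)).trans
    (clEntropy_add_le (fun v => qf_nonneg hA _) (fun v => qf_nonneg hB _)
      (summable_qf hA hAT hs) (summable_qf hB hBT hs))

theorem qEntropy_zero : qEntropy (0 : E →L[ℂ] E) = 0 := by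
  obtain ⟨s, hs⟩ := exists_isONB E
  refine le_antisymm ((iInf₂_le s hs).trans ?_) zero_le
  simp [qf, clEntropy]

theorem isPositive_sum {A : ι → E →L[ℂ] E} (hA : ∀ i, (A i).IsPositive) (J : Finset ι) :
    (∑ i ∈ J, A i).IsPositive := by
  simp_rw [← ContinuousLinearMap.nonneg_iff_isPositive] at hA ⊢
  exact Finset.sum_nonneg fun i _ => hA i

theorem traceENN_sum {A : ι → E →L[ℂ] E} (hA : ∀ i, (A i).IsPositive) (J : Finset ι) :
    traceENN (∑ i ∈ J, A i) = ∑ i ∈ J, traceENN (A i) := by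
  have h := traceENN_hasSum (fun i : J => hA i) (hasSum_fintype fun i : J => A i)
  rwa [tsum_fintype, Finset.sum_coe_sort J A, Finset.sum_coe_sort J fun i => traceENN (A i)] at h

theorem sum_qEntropy_le {A : ι → E →L[ℂ] E} (hA : ∀ i, (A i).IsPositive)
    (hT : ∀ i, traceENN (A i) ≠ ∞) (J : Finset ι) :
    ∑ i ∈ J, qEntropy (A i) ≤ qEntropy (∑ i ∈ J, A i) := by
  induction J using Finset.induction_on with
  | empty => simp
  | insert i J hi ih =>
    rw [Finset.sum_insert hi, Finset.sum_insert hi]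
    refine (add_le_add_right ih _).trans (qEntropy_add_le (hA i) (isPositive_sum hA J) (hT i) ?_)
    rw [traceENN_sum hA]
    exact ENNReal.sum_ne_top.2 fun i _ => hT i

theorem isPositive_sub_sum {A : ι → E →L[ℂ] E} {S : E →L[ℂ] E} (h : HasSum A S)
    (hA : ∀ i, (A i).IsPositive) (J : Finset ι) : (S - ∑ i ∈ J, A i).IsPositive := by
  rw [← ContinuousLinearMap.nonneg_iff_isPositive, sub_nonneg]
  exact sum_le_hasSum J (fun i _ => (ContinuousLinearMap.nonneg_iff_isPositive _).2 (hA i)) h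

theorem tsum_qEntropy_le {A : ι → E →L[ℂ] E} {S : E →L[ℂ] E} (h : HasSum A S)
    (hA : ∀ i, (A i).IsPositive) (hT : traceENN S ≠ ∞) :
    ∑' i, qEntropy (A i) ≤ qEntropy S := by
  rw [ENNReal.tsum_eq_iSup_sum]
  refine iSup_le fun J => ?_
  have hTi : ∑' i, traceENN (A i) ≠ ∞ := by rwa [← traceENN_hasSum hA h]
  have hD := isPositive_sub_sum h hA J
  have hJ := isPositive_sum hA J
  have hS : ∑ i ∈ J, A i + (S - ∑ i ∈ J, A i) = S := add_sub_cancel _ _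
  have htr := traceENN_add hJ hD
  rw [hS] at htr
  rw [htr, ENNReal.add_ne_top] at hT
  calc ∑ i ∈ J, qEntropy (A i) ≤ qEntropy (∑ i ∈ J, A i) :=
        sum_qEntropy_le hA (fun i => ENNReal.ne_top_of_tsum_ne_top hTi i) J
    _ ≤ qEntropy (∑ i ∈ J, A i) + qEntropy (S - ∑ i ∈ J, A i) := le_self_add
    _ ≤ qEntropy S := (qEntropy_add_le hJ hD hT.1 hT.2).trans_eq (by rw [hS])

/-- The entropy of a sum is at most the sum of the entropies plus the entropy of the traces. -/
theorem qEntropy_le_tsum_add [Countable ι] {A : ι → E →L[ℂ] E} {S : E →L[ℂ] E} (h : HasSum A S)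
    (hA : ∀ i, (A i).IsPositive) (hT : traceENN S ≠ ∞) :
    qEntropy S ≤ ∑' i, qEntropy (A i) + clEntropy fun i => (traceENN (A i)).toReal := by
  have hS := isPositive_of_hasSum h hA
  obtain ⟨s, hs, heig⟩ := exists_isONB_eigenvectors (isCompactOperator_of_isPositive hS hT)
    hS.isSelfAdjoint
  have hqS : ∀ v : s, S v = ((qf S v : ℝ) : ℂ) • (v : E) := by
    intro v
    obtain ⟨μ, hμ⟩ := heig v v.2
    have hn : ‖(v : E)‖ = 1 := hs.1.1 v
    rw [qf, hμ, inner_smul_right, inner_self_eq_norm_sq_to_K, hn]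
    simp
  obtain ⟨b, hb⟩ := hs.exists_hilbertBasis
  choose R hR hRA using fun i => exists_sqrt (hA i)
  by_cases htop : ∑' i, qEntropy (A i) = ∞
  · simp [htop]
  have hTi : ∑' i, traceENN (A i) ≠ ∞ := by rwa [← traceENN_hasSum hA h]
  refine ENNReal.le_of_forall_pos_le_add fun ε hε _ => ?_
  obtain ⟨ε', hε', hε's⟩ := ENNReal.exists_pos_sum_of_countable'
    (ENNReal.coe_ne_zero.2 hε.ne') ι
  have hex : ∀ i, ∃ t : Set E, IsONB t ∧
      clEntropy (fun v : t => qf (A i) v) ≤ qEntropy (A i) + ε' i := by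
    intro i
    have hlt : qEntropy (A i) < qEntropy (A i) + ε' i :=
      ENNReal.lt_add_right (ENNReal.ne_top_of_tsum_ne_top htop i) (hε' i).ne'
    conv_lhs at hlt => rw [qEntropy]
    simp only [iInf_lt_iff] at hlt
    obtain ⟨t, ht, hlt⟩ := hlt
    exact ⟨t, ht, hlt.le⟩
  choose t ht hent using hex
  choose bt hbt using fun i => (ht i).exists_hilbertBasis
  set w : (Σ i, t i) → E := fun k => R k.1 k.2 with hw
  set p : (Σ i, t i) → ℝ := fun k => qf (A k.1) k.2 with hpdef
  have hp0 : ∀ k, 0 ≤ p k := fun k => qf_nonneg (hA _) _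
  have hpw : ∀ k, p k = ‖w k‖ ^ 2 := fun k => by
    simp only [hpdef, hw]
    rw [← qf_mul_self (hR _), hRA]
  set l : s → ℝ := fun v => qf S v with hldef
  have hl0 : ∀ v, 0 ≤ l v := fun v => qf_nonneg hS _
  have hRl : ∀ i v, ‖R i v‖ ^ 2 ≤ qf S v := fun i v => by
    rw [← qf_mul_self (hR i), hRA]
    exact le_hasSum (hasSum_qf h v) i fun j _ => qf_nonneg (hA j) _
  have hRw : ∀ (k : Σ i, t i) (v : E), (inner ℂ (w k) v : ℂ) = inner ℂ (k.2 : E) (R k.1 v) :=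
    fun k v => (hR k.1).inner_left_eq_inner_right _ _
  have hw0 : ∀ (k : Σ i, t i) (v : s), l v = 0 → (inner ℂ (w k) (v : E) : ℂ) = 0 := by
    intro k v hv
    have h1 : ‖R k.1 v‖ ^ 2 ≤ 0 := (hRl k.1 v).trans_eq hv
    have h2 : R k.1 v = 0 := by simpa using le_antisymm h1 (by positivity)
    rw [hRw, h2, inner_zero_right]
  set q : s → (Σ i, t i) → ℝ := fun v k => ‖(inner ℂ (w k) (v : E) : ℂ)‖ ^ 2 / l v with hqdef
  have hlq : ∀ v k, l v * q v k = ‖(inner ℂ (w k) (v : E) : ℂ)‖ ^ 2 := by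
    intro v k
    by_cases hv : l v = 0
    · simp [hw0 k v hv, hv]
    · simp only [hqdef]; field_simp
  have hmix : clEntropy l ≤ clEntropy p := by
    refine clEntropy_le_of_mixing (q := q) hl0 (summable_qf hS hT hs)
      (fun v k => div_nonneg (by positivity) (hl0 v)) (fun k => ?_) (fun v hv => ?_) fun k J => ?_
    · simp_rw [hlq, hpw]
      have := hasSum_norm_inner_sq b (w k)
      rw [hb] at this
      simpa only [norm_inner_symm (w k)] using this
    · have hrow : ∑' k, ENNReal.ofReal (‖(inner ℂ (w k) (v : E) : ℂ)‖ ^ 2) =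
          ENNReal.ofReal (l v) := by
        have hlv : l v = qf S v := rfl
        rw [ENNReal.tsum_sigma', hlv, ← (hasSum_qf h v).tsum_eq,
          ENNReal.ofReal_tsum_of_nonneg (fun i => qf_nonneg (hA i) _) (hasSum_qf h v).summable]
        refine tsum_congr fun i => ?_
        have hi := tsum_norm_inner_sq (bt i) (R i v)
        rw [hbt i] at hi
        simp_rw [hRw, hi]
        rw [← qf_mul_self (hR i), hRA]
      have hv' : ENNReal.ofReal (l v) ≠ 0 := by simpa using (hl0 v).lt_of_ne' hv
      simp_rw [hqdef, ENNReal.ofReal_div_of_pos ((hl0 v).lt_of_ne' hv), div_eq_mul_inv]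
      rw [ENNReal.tsum_mul_right, hrow, ENNReal.mul_inv_cancel hv' ENNReal.ofReal_ne_top]
    · set c : ℝ := ∑ v ∈ J, q v k with hc
      set a : s → ℂ := fun v => (inner ℂ (v : E) (w k) : ℂ) / (l v : ℂ) with ha
      set y : E := ∑ v ∈ J, a v • (v : E) with hy
      have hterm : ∀ v, starRingEnd ℂ (a v) * (inner ℂ (v : E) (w k) : ℂ) = (q v k : ℂ) := by
        intro v
        simp only [ha, hqdef, map_div₀, Complex.conj_ofReal]
        rw [div_mul_eq_mul_div, ← Complex.normSq_eq_conj_mul_self, Complex.normSq_eq_norm_sq,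
          norm_inner_symm]
        push_cast
        rfl
      have hyw : (inner ℂ y (w k) : ℂ) = (c : ℂ) := by
        simp_rw [hy, hc, sum_inner, inner_smul_left, hterm]
        push_cast
        rfl
      have hSy : S y = ∑ v ∈ J, (inner ℂ (v : E) (w k) : ℂ) • (v : E) := by
        simp_rw [hy, map_sum, map_smul, hqS, smul_smul]
        refine Finset.sum_congr rfl fun v _ => ?_
        congr 1
        by_cases hv : l v = 0
        · rw [← inner_conj_symm, hw0 k v hv]
          simp [ha, hv]
        · exact div_mul_cancel₀ _ (Complex.ofReal_ne_zero.2 hv)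
      have hqy : qf S y = c := by
        rw [qf, hSy, hy, hs.1.inner_sum]
        simp_rw [hterm, hc]
        rw [← Complex.ofReal_sum, Complex.ofReal_re]
      have hle : c ^ 2 ≤ c := by
        have hn : ‖(k.2 : E)‖ = 1 := (ht k.1).1.1 k.2
        calc c ^ 2 = ‖(inner ℂ y (w k) : ℂ)‖ ^ 2 := by rw [hyw, Complex.norm_real]; simp
          _ = ‖(inner ℂ (k.2 : E) (R k.1 y) : ℂ)‖ ^ 2 := by rw [← hRw, norm_inner_symm]
          _ ≤ ‖R k.1 y‖ ^ 2 := by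
            refine pow_le_pow_left₀ (norm_nonneg _) ?_ 2
            simpa [hn] using norm_inner_le_norm (𝕜 := ℂ) (k.2 : E) (R k.1 y)
          _ ≤ c := (hRl k.1 y).trans_eq hqy
      nlinarith
  have hps : Summable p := by
    have hsum : ∑' k, ENNReal.ofReal (p k) ≠ ∞ := by
      rw [ENNReal.tsum_sigma']
      simpa only [hpdef, ← traceENN_eq_tsum (hA _) (ht _)] using hTi
    simpa only [ENNReal.toReal_ofReal (hp0 _)] using ENNReal.summable_toReal hsum
  refine (iInf₂_le s hs).trans (hmix.trans ((clEntropy_sigma_le hp0 hps).trans ?_))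
  have e1 : (fun i => ∑' k, p ⟨i, k⟩) = fun i => (traceENN (A i)).toReal :=
    funext fun i => tsum_qf_eq (hA i) (ht i)
  rw [e1, add_right_comm]
  gcongr
  calc ∑' i, clEntropy (fun k => p ⟨i, k⟩) ≤ ∑' i, (qEntropy (A i) + ε' i) :=
        ENNReal.tsum_le_tsum hent
    _ = ∑' i, qEntropy (A i) + ∑' i, ε' i := ENNReal.tsum_add
    _ ≤ _ := by gcongr

end Entropy

section Decomposition

variable {E ι : Type*} [NormedAddCommGroup E] [InnerProductSpace ℂ E] [CompleteSpace E]

/-- The sum of normalized mutually orthogonal positive operators is a contraction. -/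
theorem sum_qf_le_of_orthogonal {B : ι → E →L[ℂ] E} (hB : ∀ i, (B i).IsPositive)
    (hn : ∀ i, ‖B i‖ ≤ 1) (ho : ∀ i j, i ≠ j → B i * B j = 0) (J : Finset ι) (x : E) :
    ∑ i ∈ J, qf (B i) x ≤ ‖x‖ ^ 2 := by
  set c := ∑ i ∈ J, qf (B i) x with hc
  have hsq : ∀ i, ‖B i x‖ ^ 2 ≤ qf (B i) x := by
    intro i
    obtain ⟨R, hR, hRB⟩ := exists_sqrt (hB i)
    have hR1 : ‖R‖ ≤ 1 := by
      refine R.opNorm_le_bound zero_le_one fun z => ?_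
      refine le_of_sq_le_sq ?_ (by positivity)
      rw [← qf_mul_self hR, hRB, one_mul, sq]
      calc qf (B i) z ≤ ‖(inner ℂ z (B i z) : ℂ)‖ := Complex.re_le_norm _
        _ ≤ ‖z‖ * ‖B i z‖ := norm_inner_le_norm _ _
        _ ≤ ‖z‖ * ‖z‖ := by
          gcongr
          simpa using (B i).le_of_opNorm_le (hn i) z
    rw [← hRB, qf_mul_self hR]
    refine pow_le_pow_left₀ (norm_nonneg _) ?_ 2
    simpa using R.le_of_opNorm_le hR1 (R x)
  have hort : ∀ i j, i ≠ j → (inner ℂ (B i x) (B j x) : ℂ) = 0 := by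
    intro i j hij
    rw [(hB i).inner_left_eq_inner_right]
    change (inner ℂ x ((B i * B j) x) : ℂ) = 0
    simp [ho i j hij]
  have hnorm : ‖∑ i ∈ J, B i x‖ ^ 2 = ∑ i ∈ J, ‖B i x‖ ^ 2 := by
    rw [← inner_self_eq_norm_sq (𝕜 := ℂ), sum_inner, map_sum]
    refine Finset.sum_congr rfl fun i hi => ?_
    rw [inner_sum, Finset.sum_eq_single_of_mem i hi fun j _ hj => hort i j hj.symm,
      inner_self_eq_norm_sq]
  have h1 : ‖∑ i ∈ J, B i x‖ ^ 2 ≤ c := hnorm.trans_le (Finset.sum_le_sum fun i _ => hsq i)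
  have h2 : c ≤ ‖x‖ * ‖∑ i ∈ J, B i x‖ := by
    have : c = (inner ℂ x (∑ i ∈ J, B i x) : ℂ).re := by
      rw [inner_sum, Complex.re_sum]; rfl
    rw [this]
    exact (Complex.re_le_norm _).trans (norm_inner_le_norm _ _)
  nlinarith [sq_nonneg (‖x‖ - ‖∑ i ∈ J, B i x‖)]

/-- The entropy of a sum of mutually orthogonal positive operators dominates the entropy of
their traces. -/
theorem clEntropy_trace_le_qEntropy {A : ι → E →L[ℂ] E} {S : E →L[ℂ] E} (h : HasSum A S)
    (hA : ∀ i, (A i).IsPositive) (hT : traceENN S ≠ ∞) (ho : ∀ i j, i ≠ j → A i * A j = 0) :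
    clEntropy (fun i => (traceENN (A i)).toReal) ≤ qEntropy S := by
  have hTs : ∑' i, traceENN (A i) ≠ ∞ := by rwa [← traceENN_hasSum hA h]
  have hTi := fun i => ENNReal.ne_top_of_tsum_ne_top hTs i
  set τ : ι → ℝ := fun i => (traceENN (A i)).toReal with hτ
  have hτ0 : ∀ i, 0 ≤ τ i := fun i => ENNReal.toReal_nonneg
  have hqτ : ∀ i x, τ i = 0 → qf (A i) x = 0 := fun i x hi => by
    refine le_antisymm ((qf_le_trace_mul (hTi i) x).trans_eq ?_) (qf_nonneg (hA i) x)
    rw [show (traceENN (A i)).toReal = 0 from hi, zero_mul]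
  refine le_iInf₂ fun s hs => ?_
  refine clEntropy_le_of_mixing (q := fun i (v : s) => (τ i)⁻¹ * qf (A i) v) hτ0
    (ENNReal.summable_toReal hTs) (fun i v => mul_nonneg (inv_nonneg.2 (hτ0 i))
      (qf_nonneg (hA i) _)) (fun v => ?_) (fun i hi => ?_) fun v J => ?_
  · rw [show (fun i => τ i * ((τ i)⁻¹ * qf (A i) v)) = fun i => qf (A i) v from funext fun i => ?_]
    · exact hasSum_qf h v
    by_cases hi : τ i = 0
    · rw [hqτ i v hi, hi, zero_mul]
    · rw [mul_inv_cancel_left₀ hi]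
  · simp_rw [ENNReal.ofReal_mul (inv_nonneg.2 (hτ0 i))]
    rw [ENNReal.tsum_mul_left, ← traceENN_eq_tsum (hA i) hs,
      ENNReal.ofReal_inv_of_pos ((hτ0 i).lt_of_ne' hi), hτ, ENNReal.ofReal_toReal (hTi i)]
    refine ENNReal.inv_mul_cancel (fun h0 => hi ?_) (hTi i)
    simp [hτ, h0]
  · have hB : ∀ i, ((((τ i)⁻¹ : ℝ) : ℂ) • A i).IsPositive := fun i =>
      isPositive_real_smul (hA i) (inv_nonneg.2 (hτ0 i))
    have hle := sum_qf_le_of_orthogonal hB (fun i => ?_) (fun i j hij => ?_) J v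
    · simp_rw [qf_smul] at hle
      refine hle.trans_eq ?_
      rw [hs.1.1 v, one_pow]
    · rw [norm_smul, Complex.norm_real, Real.norm_of_nonneg (inv_nonneg.2 (hτ0 i))]
      exact inv_mul_le_one_of_le₀ (norm_le_trace (hA i) (hTi i)) (hτ0 i)
    · rw [smul_mul_smul_comm, ho i j hij, smul_zero]

end Decomposition

section JordanDecomposition

variable {E : Type*} [NormedAddCommGroup E] [InnerProductSpace ℂ E]

theorem traceNorm_sub_comm (A B : E →L[ℂ] E) : traceNorm (A - B) = traceNorm (B - A) := by
  have h : ∀ x y : E, ‖(inner ℂ x ((A - B) y) : ℂ)‖ = ‖(inner ℂ x ((B - A) y) : ℂ)‖ := by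
    intro x y
    rw [← neg_sub B A, neg_apply, inner_neg_right, norm_neg]
  simp only [traceNorm, h]

theorem tsum_norm_inner_le_traceNorm {ι : Type*} (A : E →L[ℂ] E) {e : ι → E}
    (he : Orthonormal ℂ e) :
    ∑' i, ENNReal.ofReal ‖(inner ℂ (e i) (A (e i)) : ℂ)‖ ≤ traceNorm A := by
  rw [ENNReal.tsum_eq_iSup_sum]
  refine iSup_le fun J => ?_
  have h : Orthonormal ℂ fun m : Fin J.card => e (J.equivFin.symm m) :=
    he.comp _ (Subtype.val_injective.comp J.equivFin.symm.injective)
  refine le_of_eq_of_le ?_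
    (le_iSup₂_of_le J.card _ (le_iSup₂_of_le _ h (le_iSup_of_le h le_rfl)))
  rw [Equiv.sum_comp J.equivFin.symm
      fun i : J => ENNReal.ofReal ‖(inner ℂ (e i) (A (e i)) : ℂ)‖,
    Finset.sum_coe_sort J fun i => ENNReal.ofReal ‖(inner ℂ (e i) (A (e i)) : ℂ)‖]

variable [CompleteSpace E]

theorem traceENN_le_traceNorm_sub {P N : E →L[ℂ] E} (hP : P.IsPositive) (hN : N.IsPositive)
    (hPN : P * N = 0) (hc : IsCompactOperator (P - N)) : traceENN P ≤ traceNorm (P - N) := by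
  obtain ⟨s, hs, heig⟩ := exists_isONB_eigenvectors (T := P - N) hc
    (hP.isSelfAdjoint.sub hN.isSelfAdjoint)
  rw [traceENN_eq_tsum hP hs]
  refine (ENNReal.tsum_le_tsum fun v => ENNReal.ofReal_le_ofReal ?_).trans
    (tsum_norm_inner_le_traceNorm (P - N) hs.1)
  obtain ⟨μ, hμ⟩ := heig v v.2
  have hn : ‖(v : E)‖ = 1 := hs.1.1 v
  have hμn : ‖(inner ℂ (v : E) ((P - N) v) : ℂ)‖ = |μ| := by
    rw [hμ, inner_smul_right, inner_self_eq_norm_sq_to_K, hn]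
    simp
  have hort : (inner ℂ (P v) (N v) : ℂ) = 0 := by
    rw [hP.inner_left_eq_inner_right]
    change (inner ℂ (v : E) ((P * N) v) : ℂ) = 0
    simp [hPN]
  have hsq : ‖P v‖ ^ 2 ≤ |μ| * ‖P v‖ := by
    have h1 : (inner ℂ (P v) ((P - N) v) : ℂ) = inner ℂ (P v) (P v) := by
      rw [sub_apply, inner_sub_right, hort, sub_zero]
    have h2 : ‖(inner ℂ (P v) (P v) : ℂ)‖ = ‖P v‖ ^ 2 := by
      rw [inner_self_eq_norm_sq_to_K]; simp
    calc ‖P v‖ ^ 2 = ‖(inner ℂ (P v) ((μ : ℂ) • (v : E)) : ℂ)‖ := by rw [← hμ, h1, h2]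
      _ ≤ ‖P v‖ * ‖(μ : ℂ) • (v : E)‖ := norm_inner_le_norm _ _
      _ = |μ| * ‖P v‖ := by rw [norm_smul, hn, Complex.norm_real, Real.norm_eq_abs]; ring
  have hPv : ‖P v‖ ≤ |μ| := by
    by_contra! hlt
    nlinarith [abs_nonneg μ]
  calc qf P v ≤ ‖(inner ℂ (v : E) (P v) : ℂ)‖ := Complex.re_le_norm _
    _ ≤ ‖(v : E)‖ * ‖P v‖ := norm_inner_le_norm _ _
    _ ≤ |μ| := by rwa [hn, one_mul]
    _ = _ := hμn.symm

/-- Two positive operators of finite trace become equal after adding positive operators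
whose traces are bounded by the trace-norm distance. -/
theorem exists_add_eq_add {A B : E →L[ℂ] E} (hA : A.IsPositive) (hB : B.IsPositive)
    (hAT : traceENN A ≠ ∞) (hBT : traceENN B ≠ ∞) :
    ∃ P N : E →L[ℂ] E, P.IsPositive ∧ N.IsPositive ∧ traceENN P ≤ traceNorm (A - B) ∧
      traceENN N ≤ traceNorm (A - B) ∧ A + N = B + P := by
  have hc : IsCompactOperator (A - B) :=
    (isCompactOperator_of_isPositive hA hAT).sub (isCompactOperator_of_isPositive hB hBT)
  have hsub : (A - B)⁺ - (A - B)⁻ = A - B :=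
    CFC.posPart_sub_negPart (A - B) (hA.isSelfAdjoint.sub hB.isSelfAdjoint)
  have hP := (ContinuousLinearMap.nonneg_iff_isPositive _).1 (CFC.posPart_nonneg (A - B))
  have hN := (ContinuousLinearMap.nonneg_iff_isPositive _).1 (CFC.negPart_nonneg (A - B))
  refine ⟨(A - B)⁺, (A - B)⁻, hP, hN, ?_, ?_, ?_⟩
  · have h := traceENN_le_traceNorm_sub hP hN (CFC.posPart_mul_negPart _)
    rw [hsub] at h
    exact h hc
  · have h := traceENN_le_traceNorm_sub hN hP (CFC.negPart_mul_posPart _)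
    rw [← neg_sub (A - B)⁺, hsub, neg_sub, traceNorm_sub_comm B, ← neg_sub A] at h
    exact h hc.neg
  · generalize (A - B)⁺ = P, (A - B)⁻ = N at hsub
    rw [eq_add_of_sub_eq hsub.symm]
    abel

end JordanDecomposition

section OutputEntropy

variable {E F ι : Type*}
variable [NormedAddCommGroup E] [InnerProductSpace ℂ E]
variable [NormedAddCommGroup F] [InnerProductSpace ℂ F]

/-- A map that is additive, positively homogeneous, positive and trace-bounded on the cone of
positive operators of finite trace. -/
structure IsPosBounded (Ψ : (E →L[ℂ] E) → (F →L[ℂ] F)) (C : ℝ) : Prop where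
  nonneg : 0 ≤ C
  pos : ∀ {A}, A.IsPositive → traceENN A ≠ ∞ → (Ψ A).IsPositive
  trace_le : ∀ {A}, A.IsPositive → traceENN A ≠ ∞ →
    traceENN (Ψ A) ≤ ENNReal.ofReal C * traceENN A
  add : ∀ {A B}, A.IsPositive → traceENN A ≠ ∞ → B.IsPositive → traceENN B ≠ ∞ →
    Ψ (A + B) = Ψ A + Ψ B
  smul : ∀ {A} {c : ℝ}, A.IsPositive → traceENN A ≠ ∞ → 0 < c → Ψ ((c : ℂ) • A) = (c : ℂ) • Ψ A

theorem IsPosBounded.trace_ne_top {Ψ : (E →L[ℂ] E) → (F →L[ℂ] F)} {C : ℝ}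
    (h : IsPosBounded Ψ C) {A : E →L[ℂ] E} (hA : A.IsPositive) (hT : traceENN A ≠ ∞) :
    traceENN (Ψ A) ≠ ∞ :=
  ne_top_of_le_ne_top (ENNReal.mul_ne_top ENNReal.ofReal_ne_top hT) (h.trace_le hA hT)

variable [CompleteSpace F]

theorem IsPosBounded.qEntropy_le_add {Ψ : (E →L[ℂ] E) → (F →L[ℂ] F)} {C : ℝ}
    (h : IsPosBounded Ψ C) {A B : E →L[ℂ] E} (hA : A.IsPositive)
    (hAT : traceENN A ≠ ∞) (hB : B.IsPositive) (hBT : traceENN B ≠ ∞) :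
    qEntropy (Ψ A) ≤ qEntropy (Ψ (A + B)) := by
  rw [h.add hA hAT hB hBT]
  exact le_self_add.trans (qEntropy_add_le (h.pos hA hAT) (h.pos hB hBT)
    (h.trace_ne_top hA hAT) (h.trace_ne_top hB hBT))

variable [CompleteSpace E]

theorem smul_inv_mem_states {A : E →L[ℂ] E} (hA : A.IsPositive) (hT : traceENN A ≠ ∞)
    (h0 : traceENN A ≠ 0) : (((traceENN A).toReal⁻¹ : ℝ) : ℂ) • A ∈ states E := by
  have ht : 0 < (traceENN A).toReal := ENNReal.toReal_pos h0 hT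
  refine ⟨isPositive_real_smul hA (inv_nonneg.2 ht.le), ?_⟩
  rw [traceENN_smul hA (inv_nonneg.2 ht.le), ENNReal.ofReal_inv_of_pos ht,
    ENNReal.ofReal_toReal hT, ENNReal.inv_mul_cancel h0 hT]

theorem eq_zero_of_traceENN_eq_zero {A : E →L[ℂ] E} (hA : A.IsPositive) (h : traceENN A = 0) :
    A = 0 :=
  norm_le_zero_iff.1 ((norm_le_trace hA (by simp [h])).trans_eq (by simp [h]))

theorem qEntropy_add_le_add {A B : E →L[ℂ] E} (hA : A.IsPositive) (hB : B.IsPositive) {c d : ℝ}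
    (hc : 0 ≤ c) (hd : 0 ≤ d) (hAc : traceENN A ≤ ENNReal.ofReal c)
    (hBd : traceENN B ≤ ENNReal.ofReal d) :
    qEntropy (A + B) ≤
      qEntropy A + qEntropy B + ENNReal.ofReal (d + 2 * √(d * (c + d))) := by
  have hsum : HasSum (fun i : Bool => cond i B A) (A + B) := by
    rw [add_comm A B]
    simpa using hasSum_fintype fun i : Bool => cond i B A
  have hT : traceENN (A + B) ≠ ∞ := by
    rw [traceENN_add hA hB]
    exact ENNReal.add_ne_top.2 ⟨ne_top_of_le_ne_top ENNReal.ofReal_ne_top hAc,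
      ne_top_of_le_ne_top ENNReal.ofReal_ne_top hBd⟩
  refine (qEntropy_le_tsum_add hsum (by rintro (_ | _) <;> assumption) hT).trans
    (add_le_add ?_ (clEntropy_bool_le (fun _ => ENNReal.toReal_nonneg)
      (ENNReal.toReal_le_of_le_ofReal hc hAc) (ENNReal.toReal_le_of_le_ofReal hd hBd)))
  rw [tsum_bool]
  rfl

namespace IsPosBounded

variable {Ψ : (E →L[ℂ] E) → (F →L[ℂ] F)} {C : ℝ}

theorem exists_bound_states (h : IsPosBounded Ψ C)
    (hfin : ∀ ρ ∈ states E, qEntropy (Ψ ρ) ≠ ∞) :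
    ∃ M : ℝ≥0, ∀ ρ ∈ states E, qEntropy (Ψ ρ) ≤ M := by
  by_contra! hM
  set c : ℕ → ℝ := fun n => 1 / 2 / 2 ^ n with hc
  have hc0 : ∀ n, 0 < c n := fun n => by simp only [hc]; positivity
  choose ρ hρ hlt using fun n : ℕ => hM (n / c n).toNNReal
  set A : ℕ → E →L[ℂ] E := fun n => (c n : ℂ) • ρ n with hAdef
  have hA : ∀ n, (A n).IsPositive := fun n => isPositive_real_smul (hρ n).1 (hc0 n).le
  have htr : ∀ n, traceENN (A n) = ENNReal.ofReal (c n) := fun n => by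
    rw [hAdef, traceENN_smul (hρ n).1 (hc0 n).le, (hρ n).2, mul_one]
  have hcs : HasSum c 1 := hasSum_geometric_two' 1
  have htrs : ∑' n, traceENN (A n) = 1 := by
    simp_rw [htr]
    rw [← ENNReal.ofReal_tsum_of_nonneg (fun n => (hc0 n).le) hcs.summable, hcs.tsum_eq,
      ENNReal.ofReal_one]
  have hS := (summable_of_tsum_traceENN_ne_top hA (by simp [htrs])).hasSum
  set S := ∑' n, A n
  have hSst : S ∈ states E :=
    ⟨isPositive_of_hasSum hS hA, by rw [traceENN_hasSum hA hS, htrs]⟩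
  refine hfin S hSst (ENNReal.eq_top_of_forall_nnreal_le fun r => ?_)
  obtain ⟨n, hn⟩ := exists_nat_ge r
  have hD := isPositive_sub_sum hS hA {n}
  rw [Finset.sum_singleton] at hD
  have hsplit : A n + (S - A n) = S := add_sub_cancel _ _
  have hST := traceENN_add (hA n) hD
  rw [hsplit, hSst.2] at hST
  have hfinT := ENNReal.add_ne_top.1 (hST ▸ ENNReal.one_ne_top)
  calc (r : ℝ≥0∞) ≤ (n : ℝ≥0∞) := by exact_mod_cast hn
    _ = ENNReal.ofReal (c n) * ENNReal.ofReal (n / c n) := by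
      rw [← ENNReal.ofReal_mul (hc0 n).le, mul_div_cancel₀ _ (hc0 n).ne', ENNReal.ofReal_natCast]
    _ ≤ ENNReal.ofReal (c n) * qEntropy (Ψ (ρ n)) := by
      gcongr
      exact (hlt n).le
    _ = qEntropy (Ψ (A n)) := by
      rw [hAdef, h.smul (hρ n).1 (by simp [(hρ n).2]) (hc0 n), qEntropy_smul (hc0 n)]
    _ ≤ qEntropy (Ψ S) := (h.qEntropy_le_add (hA n) hfinT.1 hD hfinT.2).trans_eq (by rw [hsplit])

theorem exists_bound (h : IsPosBounded Ψ C) (hfin : ∀ ρ ∈ states E, qEntropy (Ψ ρ) ≠ ∞) :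
    ∃ M : ℝ≥0, ∀ A : E →L[ℂ] E, A.IsPositive → traceENN A ≠ ∞ →
      qEntropy (Ψ A) ≤ M * traceENN A := by
  obtain ⟨M, hM⟩ := h.exists_bound_states hfin
  refine ⟨M, fun A hA hT => ?_⟩
  by_cases h0 : traceENN A = 0
  · have hΨ : traceENN (Ψ A) = 0 := by simpa [h0] using h.trace_le hA hT
    rw [eq_zero_of_traceENN_eq_zero (h.pos hA hT) hΨ, qEntropy_zero]
    exact zero_le
  have ht : 0 < (traceENN A).toReal := ENNReal.toReal_pos h0 hT
  have hb := hM _ (smul_inv_mem_states hA hT h0)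
  rw [h.smul hA hT (inv_pos.2 ht), qEntropy_smul (inv_pos.2 ht), ENNReal.ofReal_inv_of_pos ht,
    ENNReal.ofReal_toReal hT] at hb
  rw [mul_comm]
  exact (ENNReal.inv_mul_le_iff h0 hT).1 hb

/-- Finiteness of the output entropy on the set of states implies its continuity. -/
theorem contOn_qEntropy (h : IsPosBounded Ψ C) (hfin : ∀ ρ ∈ states E, qEntropy (Ψ ρ) ≠ ∞) :
    ContOn (fun ρ => qEntropy (Ψ ρ)) (states E) := by
  obtain ⟨M, hM⟩ := h.exists_bound hfin
  set ω : ℝ → ℝ := fun δ => M * δ + (C * δ + 2 * √(C * δ * (C + C * δ))) with hω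
  have hest : ∀ {δ : ℝ}, 0 ≤ δ → ∀ {A P N : E →L[ℂ] E} {B : E →L[ℂ] E}, A ∈ states E →
      B ∈ states E → P.IsPositive → N.IsPositive → traceENN P ≤ ENNReal.ofReal δ →
      traceENN N ≤ ENNReal.ofReal δ → A + N = B + P →
      (qEntropy (Ψ A)).toReal ≤ (qEntropy (Ψ B)).toReal + ω δ := by
    intro δ hδ A P N B hA hB hP hN hPδ hNδ hadd
    have hPT := ne_top_of_le_ne_top ENNReal.ofReal_ne_top hPδ
    have hNT := ne_top_of_le_ne_top ENNReal.ofReal_ne_top hNδ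
    have hAT : traceENN A ≠ ∞ := by simp [hA.2]
    have hBT : traceENN B ≠ ∞ := by simp [hB.2]
    have hω1 : 0 ≤ C * δ + 2 * √(C * δ * (C + C * δ)) :=
      add_nonneg (mul_nonneg h.nonneg hδ) (by positivity)
    have key : qEntropy (Ψ A) ≤ qEntropy (Ψ B) + ENNReal.ofReal (ω δ) := by
      calc qEntropy (Ψ A) ≤ qEntropy (Ψ (A + N)) := h.qEntropy_le_add hA.1 hAT hN hNT
        _ = qEntropy (Ψ B + Ψ P) := by rw [hadd, h.add hB.1 hBT hP hPT]
        _ ≤ qEntropy (Ψ B) + qEntropy (Ψ P) +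
            ENNReal.ofReal (C * δ + 2 * √(C * δ * (C + C * δ))) := by
          refine qEntropy_add_le_add (h.pos hB.1 hBT) (h.pos hP hPT) h.nonneg
            (mul_nonneg h.nonneg hδ) ?_ ?_
          · simpa [hB.2] using h.trace_le hB.1 hBT
          · rw [ENNReal.ofReal_mul h.nonneg]
            exact (h.trace_le hP hPT).trans (by gcongr)
        _ ≤ qEntropy (Ψ B) + ENNReal.ofReal (M * δ) +
            ENNReal.ofReal (C * δ + 2 * √(C * δ * (C + C * δ))) := by
          gcongr
          refine (hM P hP hPT).trans ?_
          rw [ENNReal.ofReal_mul M.coe_nonneg, ENNReal.ofReal_coe_nnreal]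
          gcongr
        _ = _ := by
          rw [add_assoc, ← ENNReal.ofReal_add (by positivity) hω1]
    have hω0 : 0 ≤ ω δ := add_nonneg (by positivity) hω1
    rw [← ENNReal.toReal_ofReal hω0, ← ENNReal.toReal_add (hfin B hB) ENNReal.ofReal_ne_top]
    exact ENNReal.toReal_mono (ENNReal.add_ne_top.2 ⟨hfin B hB, ENNReal.ofReal_ne_top⟩) key
  refine ⟨hfin, fun A hA ε hε => ?_⟩
  have hcont : Continuous ω := by fun_prop
  have hlim : Tendsto ω (𝓝[>] 0) (𝓝 0) := by
    have := hcont.tendsto 0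
    simp only [hω, mul_zero, zero_mul, add_zero, Real.sqrt_zero] at this
    exact this.mono_left nhdsWithin_le_nhds
  obtain ⟨δ, hδε, hδ⟩ := ((hlim.eventually (gt_mem_nhds hε)).and self_mem_nhdsWithin).exists
  refine ⟨δ, hδ, fun B hB hBA => ?_⟩
  obtain ⟨P, N, hP, hN, hPt, hNt, hadd⟩ :=
    exists_add_eq_add hB.1 hA.1 (by simp [hB.2]) (by simp [hA.2])
  have h1 := hest hδ.le hB hA hP hN (hPt.trans hBA.le) (hNt.trans hBA.le) hadd
  have h2 := hest hδ.le hA hB hN hP (hNt.trans hBA.le) (hPt.trans hBA.le) hadd.symm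
  rw [abs_lt]
  constructor <;> linarith

end IsPosBounded

/-- The scaled bound on the total output trace of a family of positive maps. -/
theorem tsum_traceENN_le {Φ : ι → TraceMap E F} {C : ℝ}
    (hsup : ∀ ρ ∈ states E, (∑' i, traceENN ((Φ i).toFun ρ)) ≤ ENNReal.ofReal C)
    {A : E →L[ℂ] E} (hA : A.IsPositive) (hT : traceENN A ≠ ∞) :
    ∑' i, traceENN ((Φ i).toFun A) ≤ ENNReal.ofReal C * traceENN A := by
  have htc := isTC_of_isPositive hA hT
  by_cases h0 : traceENN A = 0
  · have hz : ∀ i, (Φ i).toFun A = 0 := fun i => by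
      have h1 := (Φ i).map_smul 0 A htc
      rwa [zero_smul, zero_smul, ← eq_zero_of_traceENN_eq_zero hA h0] at h1
    simp [hz, traceENN, qf]
  have ht : 0 < (traceENN A).toReal := ENNReal.toReal_pos h0 hT
  have hb := hsup _ (smul_inv_mem_states hA hT h0)
  simp_rw [(Φ _).map_smul _ A htc,
    traceENN_smul ((Φ _).pos A htc hA) (inv_nonneg.2 ht.le)] at hb
  rw [ENNReal.tsum_mul_left, ENNReal.ofReal_inv_of_pos ht, ENNReal.ofReal_toReal hT] at hb
  rw [mul_comm]
  exact (ENNReal.inv_mul_le_iff h0 hT).1 hb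

theorem hasSum_toFun {Φ : ι → TraceMap E F} {C : ℝ}
    (hsup : ∀ ρ ∈ states E, (∑' i, traceENN ((Φ i).toFun ρ)) ≤ ENNReal.ofReal C)
    {A : E →L[ℂ] E} (hA : A.IsPositive) (hT : traceENN A ≠ ∞) :
    HasSum (fun i => (Φ i).toFun A) (∑' i, (Φ i).toFun A) :=
  (summable_of_tsum_traceENN_ne_top
    (fun i => (Φ i).pos A (isTC_of_isPositive hA hT) hA)
    (ne_top_of_le_ne_top (ENNReal.mul_ne_top ENNReal.ofReal_ne_top hT)
      (tsum_traceENN_le hsup hA hT))).hasSum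

theorem isPosBounded_tsum {Φ : ι → TraceMap E F} {C : ℝ}
    (hsup : ∀ ρ ∈ states E, (∑' i, traceENN ((Φ i).toFun ρ)) ≤ ENNReal.ofReal C) :
    IsPosBounded (fun A => ∑' i, (Φ i).toFun A) (max C 0) where
  nonneg := le_max_right _ _
  pos hA hT := isPositive_of_hasSum (hasSum_toFun hsup hA hT)
    fun i => (Φ i).pos _ (isTC_of_isPositive hA hT) hA
  trace_le hA hT := by
    rw [traceENN_hasSum (fun i => (Φ i).pos _ (isTC_of_isPositive hA hT) hA)
      (hasSum_toFun hsup hA hT)]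
    refine (tsum_traceENN_le hsup hA hT).trans ?_
    gcongr
    exact le_max_left _ _
  add hA hAT hB hBT := by
    simp_rw [(Φ _).map_add _ _ (isTC_of_isPositive hA hAT) (isTC_of_isPositive hB hBT)]
    exact ((hasSum_toFun hsup hA hAT).add (hasSum_toFun hsup hB hBT)).tsum_eq
  smul hA hT _ := by
    simp_rw [(Φ _).map_smul _ _ (isTC_of_isPositive hA hT)]
    exact ((hasSum_toFun hsup hA hT).const_smul _).tsum_eq

end OutputEntropy

/-- Corollary 2 of the paper. Let `{Φᵢ}_{i∈I}` be a finite or countable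
family of positive linear trace-non-increasing maps with
`sup_ρ ∑ᵢ Tr Φᵢ(ρ) < ∞`.  If `∑ᵢ H(Φᵢ(ρ)) < ∞` and `H({Tr Φᵢ(ρ)}) < ∞` for every state
`ρ`, then the output entropy of `∑ᵢ Φᵢ` is continuous on `𝔖(H)`; this condition is also
necessary if either the supports of `Φᵢ(ρ)` are pairwise orthogonal for all `ρ`, or `I`
is finite. -/
theorem statement3
    {E F : Type*}
    [NormedAddCommGroup E] [InnerProductSpace ℂ E] [CompleteSpace E]
    [TopologicalSpace.SeparableSpace E]
    [NormedAddCommGroup F] [InnerProductSpace ℂ F] [CompleteSpace F]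
    [TopologicalSpace.SeparableSpace F]
    {I : Type*} [Countable I]
    (Φ : I → TraceMap E F) (hTNI : ∀ i, (Φ i).TNI)
    (hsup : ∃ C : ℝ, ∀ ρ ∈ states E, (∑' i, traceENN ((Φ i).toFun ρ)) ≤ ENNReal.ofReal C) :
    (((∀ ρ ∈ states E,
        (∑' i, qEntropy ((Φ i).toFun ρ)) ≠ ∞ ∧
        clEntropy (fun i => (traceENN ((Φ i).toFun ρ)).toReal) ≠ ∞) →
      ContOn (fun ρ => qEntropy (∑' i, (Φ i).toFun ρ)) (states E))) ∧
    (((∀ ρ ∈ states E, ∀ i j : I, i ≠ j →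
        (Φ i).toFun ρ * (Φ j).toFun ρ = 0) ∨ Finite I) →
      ContOn (fun ρ => qEntropy (∑' i, (Φ i).toFun ρ)) (states E) →
      ∀ ρ ∈ states E,
        (∑' i, qEntropy ((Φ i).toFun ρ)) ≠ ∞ ∧
        clEntropy (fun i => (traceENN ((Φ i).toFun ρ)).toReal) ≠ ∞) := by
  obtain ⟨C, hC⟩ := hsup
  have hΨ := isPosBounded_tsum hC
  have hT : ∀ ρ ∈ states E, traceENN ρ ≠ ∞ := fun ρ hρ => by simp [hρ.2]
  have hpos : ∀ ρ ∈ states E, ∀ i, ((Φ i).toFun ρ).IsPositive := fun ρ hρ i =>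
    (Φ i).pos ρ (isTC_of_isPositive hρ.1 (hT ρ hρ)) hρ.1
  have hsum := fun ρ (hρ : ρ ∈ states E) => hasSum_toFun hC hρ.1 (hT ρ hρ)
  have hTΨ := fun ρ (hρ : ρ ∈ states E) => hΨ.trace_ne_top hρ.1 (hT ρ hρ)
  refine ⟨fun hcond => hΨ.contOn_qEntropy fun ρ hρ => ?_, fun hor hcont ρ hρ => ⟨?_, ?_⟩⟩
  · exact ne_top_of_le_ne_top (ENNReal.add_ne_top.2 (hcond ρ hρ))
      (qEntropy_le_tsum_add (hsum ρ hρ) (hpos ρ hρ) (hTΨ ρ hρ))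
  · exact ne_top_of_le_ne_top (hcont.1 ρ hρ)
      (tsum_qEntropy_le (hsum ρ hρ) (hpos ρ hρ) (hTΨ ρ hρ))
  · rcases hor with ho | hfin
    · exact ne_top_of_le_ne_top (hcont.1 ρ hρ)
        (clEntropy_trace_le_qEntropy (hsum ρ hρ) (hpos ρ hρ) (hTΨ ρ hρ) (ho ρ hρ))
    · exact clEntropy_ne_top_of_finite _

end QIT
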